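/- arXiv:1912.03759 — 5 statements merged into one kernel-verified Lean document; each statement's English description precedes it below -/
import Mathlib

section
/- Anick's tame approximation theorem: let K be a field of characteristic zero, N ≥ 1, and let φ be a K-algebra automorphism of K[x_1,…,x_N] whose Jacobian determinant det(∂φ(x_i)/∂x_j) equals 1. Then for every k ∈ ℕ there exists a tame automorphism ψ (an element of the subgroup of Aut_K(K[x_1,…,x_N]) generated by all elementary automorphisms) such that for every i, the polynomial (ψ^{-1}∘φ)(x_i) − x_i has height ≥ k, i.e. tame automorphisms approximate φ in the formal power series topology. -/
/-- An algebra automorphism of `K[x_1,…,x_N]` is *elementary* if for some index `m`,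
some scalar `a ≠ 0` and some polynomial `f` not involving `x_m`, it sends
`x_m ↦ a·x_m + f` and fixes all other variables. -/
def IsElementaryAut {K : Type*} [Field K] {N : ℕ}
    (e : MvPolynomial (Fin N) K ≃ₐ[K] MvPolynomial (Fin N) K) : Prop :=
  ∃ (m : Fin N) (a : K) (f : MvPolynomial (Fin N) K),
    a ≠ 0 ∧
    f ∈ Algebra.adjoin K (MvPolynomial.X '' {j : Fin N | j ≠ m}) ∧
    e (MvPolynomial.X m) = MvPolynomial.C a * MvPolynomial.X m + f ∧
    ∀ j : Fin N, j ≠ m → e (MvPolynomial.X j) = MvPolynomial.X j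

/-- A polynomial `h` has height `≥ k` if every monomial occurring in `h` with nonzero
coefficient has total degree `≥ k`. -/
def HeightGE {K : Type*} [Field K] {N : ℕ} (h : MvPolynomial (Fin N) K) (k : ℕ) : Prop :=
  ∀ d ∈ h.support, k ≤ d.sum fun _ e => e


open MvPolynomial

namespace Anick

variable {K : Type*} [Field K] {N : ℕ}

/-- The tame subgroup. -/
noncomputable abbrev Tame (K : Type*) [Field K] (N : ℕ) :
    Subgroup (MvPolynomial (Fin N) K ≃ₐ[K] MvPolynomial (Fin N) K) :=
  Subgroup.closure {e : MvPolynomial (Fin N) K ≃ₐ[K] MvPolynomial (Fin N) K | IsElementaryAut e}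

/-- The ideal of polynomials vanishing at the origin. -/
noncomputable abbrev mm (K : Type*) [Field K] (N : ℕ) : Ideal (MvPolynomial (Fin N) K) :=
  idealOfVars (Fin N) K

lemma heightGE_iff (h : MvPolynomial (Fin N) K) (k : ℕ) : HeightGE h k ↔ h ∈ mm K N ^ k := by
  rw [mem_pow_idealOfVars_iff]
  rfl

lemma fix_of_supported {s : Set (Fin N)} {f : MvPolynomial (Fin N) K}
    (hf : f ∈ Algebra.adjoin K (X '' s))
    (e : MvPolynomial (Fin N) K →ₐ[K] MvPolynomial (Fin N) K) (he : ∀ j ∈ s, e (X j) = X j) :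
    e f = f := by
  have : Set.EqOn e (AlgHom.id K _) (X '' s) := by
    rintro _ ⟨j, hj, rfl⟩
    simpa using he j hj
  exact (AlgHom.eqOn_adjoin_iff.2 this) hf

lemma exists_elementary (m : Fin N) (a : K) (ha : a ≠ 0) (f : MvPolynomial (Fin N) K)
    (hf : f ∈ Algebra.adjoin K (X '' {j : Fin N | j ≠ m})) :
    ∃ e ∈ Tame K N, e (X m) = C a * X m + f ∧ ∀ j, j ≠ m → e (X j) = X j := by
  let e1 : MvPolynomial (Fin N) K →ₐ[K] MvPolynomial (Fin N) K :=
    aeval (Function.update X m (C a * X m + f))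
  let e2 : MvPolynomial (Fin N) K →ₐ[K] MvPolynomial (Fin N) K :=
    aeval (Function.update X m (C a⁻¹ * (X m - f)))
  have h1 : ∀ j, j ≠ m → e1 (X j) = X j := fun j hj => by simp [e1, hj]
  have h2 : ∀ j, j ≠ m → e2 (X j) = X j := fun j hj => by simp [e2, hj]
  have h1m : e1 (X m) = C a * X m + f := by simp [e1]
  have h2m : e2 (X m) = C a⁻¹ * (X m - f) := by simp [e2]
  have f1 : e1 f = f := fix_of_supported hf e1 h1
  have f2 : e2 f = f := fix_of_supported hf e2 h2
  have c1 : ∀ c : K, e1 (C c) = C c := fun c => by simp [e1, algHom_C]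
  have c2 : ∀ c : K, e2 (C c) = C c := fun c => by simp [e2, algHom_C]
  have hC : (C a : MvPolynomial (Fin N) K) * C a⁻¹ = 1 := by
    rw [← C_mul, mul_inv_cancel₀ ha, C_1]
  have h12 : e1.comp e2 = AlgHom.id K _ := by
    apply MvPolynomial.algHom_ext
    intro j
    by_cases hj : j = m
    · subst hj
      simp only [AlgHom.comp_apply, h2m, map_mul, map_sub, h1m, f1, c1, AlgHom.id_apply]
      linear_combination X j * hC
    · simp [h1 j hj, h2 j hj]
  have h21 : e2.comp e1 = AlgHom.id K _ := by
    apply MvPolynomial.algHom_ext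
    intro j
    by_cases hj : j = m
    · subst hj
      simp only [AlgHom.comp_apply, h1m, map_mul, map_add, h2m, f2, c2, AlgHom.id_apply]
      linear_combination (X j - f) * hC
    · simp [h1 j hj, h2 j hj]
  refine ⟨AlgEquiv.ofAlgHom e1 e2 h12 h21, Subgroup.subset_closure ⟨m, a, f, ha, hf, h1m, h1⟩,
    h1m, h1⟩

/-- translations are tame -/
lemma exists_translation (p : Fin N → K) : ∃ e ∈ Tame K N, ∀ i, e (X i) = X i + C (p i) := by
  let S : AddSubmonoid (Fin N → K) :=
    { carrier := {p | ∃ e ∈ Tame K N, ∀ i, e (X i) = X i + C (p i)}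
      zero_mem' := ⟨1, one_mem _, fun i => by simp⟩
      add_mem' := by
        rintro p q ⟨e, he, h⟩ ⟨e', he', h'⟩
        refine ⟨e * e', mul_mem he he', fun i => ?_⟩
        simp only [AlgEquiv.mul_apply, h', map_add, h, Pi.add_apply]
        rw [show e (C (q i)) = C (q i) from e.commutes (q i)]
        ring }
  change p ∈ S
  rw [← Finset.univ_sum_single p]
  refine sum_mem fun m _ => ?_
  obtain ⟨e, he, h1, h2⟩ := exists_elementary m (1 : K) one_ne_zero (C (p m))
    (Subalgebra.algebraMap_mem _ (p m))
  refine ⟨e, he, fun i => ?_⟩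
  by_cases hi : i = m
  · subst hi; simp [h1]
  · simp [h2 i hi, hi]

/-- `A` acts as a tame linear automorphism. -/
def LinTame (A : Matrix (Fin N) (Fin N) K) : Prop :=
  ∃ e ∈ Tame K N, ∀ i, e (X i) = ∑ j, C (A i j) * X j

lemma LinTame.mul {A B : Matrix (Fin N) (Fin N) K} (hA : LinTame A) (hB : LinTame B) :
    LinTame (A * B) := by
  obtain ⟨e, he, h⟩ := hA
  obtain ⟨e', he', h'⟩ := hB
  refine ⟨e' * e, mul_mem he' he, fun i => ?_⟩
  have c : ∀ c : K, e' (C c) = C c := fun c => e'.commutes c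
  simp only [AlgEquiv.mul_apply, h, map_sum, map_mul, c, h', Matrix.mul_apply, Finset.mul_sum,
    Finset.sum_mul]
  rw [Finset.sum_comm]
  simp only [mul_assoc]

lemma LinTame.one : LinTame (1 : Matrix (Fin N) (Fin N) K) :=
  ⟨1, one_mem _, fun i => by simp [Matrix.one_apply, apply_ite (C (σ := Fin N) (R := K))]⟩

lemma linTame_diagonal (D : Fin N → K) (hD : ∀ i, D i ≠ 0) : LinTame (Matrix.diagonal D) := by
  have key : ∀ s : Finset (Fin N),
      LinTame (Matrix.diagonal (fun i => if i ∈ s then D i else 1)) := by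
    intro s
    induction s using Finset.induction_on with
    | empty => simpa using LinTame.one
    | insert m s hm ih =>
      obtain ⟨e, he, h1, h2⟩ := exists_elementary m (D m) (hD m) 0 (zero_mem _)
      have h : LinTame (Matrix.diagonal (fun i => if i = m then D i else 1)) := by
        refine ⟨e, he, fun i => ?_⟩
        by_cases hi : i = m
        · subst hi
          simp [h1, Matrix.diagonal_apply, apply_ite (C (σ := Fin N) (R := K))]
        · simp [h2 i hi, hi, Matrix.diagonal_apply, apply_ite (C (σ := Fin N) (R := K))]
      have := h.mul ih
      rw [Matrix.diagonal_mul_diagonal] at this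
      convert this using 2
      ext i
      by_cases hi : i = m
      · subst hi; simp [hm]
      · simp [hi]
  simpa using key Finset.univ

lemma linTame_of_det (A : Matrix (Fin N) (Fin N) K) (hA : A.det ≠ 0) : LinTame A := by
  refine Matrix.diagonal_transvection_induction_of_det_ne_zero LinTame A hA ?_ ?_ ?_
  · intro D hD
    rw [Matrix.det_diagonal] at hD
    exact linTame_diagonal D fun i => (Finset.prod_ne_zero_iff.1 hD) i (Finset.mem_univ _)
  · rintro ⟨i, j, hij, c⟩
    obtain ⟨e, he, h1, h2⟩ := exists_elementary i (1 : K) one_ne_zero (C c * X j)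
      (mul_mem (Subalgebra.algebraMap_mem _ c) (Algebra.subset_adjoin ⟨j, hij.symm, rfl⟩))
    refine ⟨e, he, fun l => ?_⟩
    by_cases hl : l = i
    · subst hl
      simp [h1, Matrix.TransvectionStruct.toMatrix, Matrix.transvection, Matrix.one_apply,
        Matrix.single_apply, add_mul, Finset.sum_add_distrib,
        apply_ite (C (σ := Fin N) (R := K))]
    · simp [h2 l hl, Matrix.TransvectionStruct.toMatrix, Matrix.transvection, Matrix.one_apply,
        Matrix.single_apply, add_mul, Finset.sum_add_distrib, Ne.symm hl,
        apply_ite (C (σ := Fin N) (R := K))]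
  · intro A B _ _ h1 h2
    exact h1.mul h2

/-! ### Filtration -/

lemma map_mm_pow (e : MvPolynomial (Fin N) K →ₐ[K] MvPolynomial (Fin N) K)
    (he : ∀ i, e (X i) ∈ mm K N) (k : ℕ) {p : MvPolynomial (Fin N) K} (hp : p ∈ mm K N ^ k) :
    e p ∈ mm K N ^ k := by
  have h1 : (mm K N).map e ≤ mm K N := by
    rw [Ideal.map_span, Ideal.span_le]
    rintro _ ⟨_, ⟨i, rfl⟩, rfl⟩
    exact he i
  have h2 : e p ∈ (mm K N ^ k).map e := Ideal.mem_map_of_mem _ hp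
  rw [Ideal.map_pow] at h2
  exact Ideal.pow_right_mono h1 k h2

lemma X_mem (i : Fin N) : (X i : MvPolynomial (Fin N) K) ∈ mm K N :=
  Ideal.subset_span ⟨i, rfl⟩

lemma mem_of_sub_mem_sq (e : MvPolynomial (Fin N) K →ₐ[K] MvPolynomial (Fin N) K)
    (he : ∀ i, e (X i) - X i ∈ mm K N ^ 2) (i : Fin N) : e (X i) ∈ mm K N := by
  have := add_mem (Ideal.pow_le_self two_ne_zero (he i)) (X_mem (K := K) i)
  simpa using this

lemma sub_mem_succ (e : MvPolynomial (Fin N) K →ₐ[K] MvPolynomial (Fin N) K)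
    (he : ∀ i, e (X i) - X i ∈ mm K N ^ 2) (k : ℕ) {p : MvPolynomial (Fin N) K}
    (hp : p ∈ mm K N ^ k) : e p - p ∈ mm K N ^ (k + 1) := by
  have he' := mem_of_sub_mem_sq e he
  -- every polynomial moves by an element of the ideal
  have h0 : ∀ p, e p - p ∈ mm K N := by
    intro p
    induction p using MvPolynomial.induction_on with
    | C a => simp [algHom_C]
    | add p q hp hq =>
      have := add_mem hp hq
      rw [map_add]; convert this using 1; ring
    | mul_X p i hp =>
      rw [map_mul]
      exact sub_mem (Ideal.mul_mem_left _ _ (he' i)) (Ideal.mul_mem_left _ _ (X_mem i))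
  have h1 : ∀ p ∈ mm K N, e p - p ∈ mm K N ^ 2 := by
    intro p hp
    refine Submodule.span_induction (p := fun x _ => e x - x ∈ mm K N ^ 2) ?_ ?_ ?_ ?_ hp
    · rintro _ ⟨i, rfl⟩; exact he i
    · simp
    · intro x y _ _ hx hy
      have := add_mem hx hy
      rw [map_add]; convert this using 1; ring
    · intro a x hx' hx
      rw [smul_eq_mul, map_mul,
        show e a * e x - a * x = e a * (e x - x) + (e a - a) * x by ring]
      refine add_mem (Ideal.mul_mem_left _ _ hx) ?_
      rw [pow_two]; exact Ideal.mul_mem_mul (h0 a) hx'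
  induction k generalizing p with
  | zero => simpa using h0 p
  | succ k ih =>
    rw [pow_succ] at hp
    refine Submodule.mul_induction_on hp ?_ ?_
    · intro a ha b hb
      rw [map_mul, show e a * e b - a * b = (e a - a) * e b + a * (e b - b) by ring]
      refine add_mem ?_ ?_
      · rw [pow_succ]
        refine Ideal.mul_mem_mul (ih ha) ?_
        have := map_mm_pow e he' 1 (p := b) (by simpa using hb)
        simpa using this
      · rw [add_assoc, pow_add]
        exact Ideal.mul_mem_mul ha (h1 b hb)
    · intro x y hx hy
      have := add_mem hx hy
      rw [map_add]; convert this using 1; ring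

lemma pderiv_mem (i : Fin N) (k : ℕ) {p : MvPolynomial (Fin N) K} (hp : p ∈ mm K N ^ (k + 1)) :
    pderiv i p ∈ mm K N ^ k := by
  rw [mem_pow_idealOfVars_iff'] at hp ⊢
  intro x hx
  rw [coeff_pderiv, hp, zero_mul]
  simpa using hx

lemma homog_mem {k : ℕ} {p : MvPolynomial (Fin N) K} (hp : p.IsHomogeneous k) :
    p ∈ mm K N ^ k := by
  rw [mem_pow_idealOfVars_iff]
  intro x hx
  rw [mem_support_iff] at hx
  have := hp hx
  rw [Finsupp.degree_eq_weight_one]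
  exact this.ge

lemma homog_eq_zero {k : ℕ} {p : MvPolynomial (Fin N) K} (hp : p.IsHomogeneous k)
    (h : p ∈ mm K N ^ (k + 1)) : p = 0 := by
  ext x
  rw [coeff_zero]
  by_contra hx
  have h2 := hp hx
  rw [mem_pow_idealOfVars_iff'] at h
  refine hx (h x ?_)
  rw [Finsupp.degree_eq_weight_one]
  exact Nat.lt_succ_of_le h2.le

lemma sub_homog_mem {k : ℕ} {p : MvPolynomial (Fin N) K} (hp : p ∈ mm K N ^ k) :
    p - homogeneousComponent k p ∈ mm K N ^ (k + 1) := by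
  rw [mem_pow_idealOfVars_iff'] at hp ⊢
  intro x hx
  rw [coeff_sub, coeff_homogeneousComponent]
  split_ifs with h
  · simp
  · rw [hp x (by omega), sub_zero]

lemma taylor (p : MvPolynomial (Fin N) K) :
    p - C (constantCoeff p) - ∑ j, C (constantCoeff (pderiv j p)) * X j ∈ mm K N ^ 2 := by
  have hc : ∀ p : MvPolynomial (Fin N) K, p - C (constantCoeff p) ∈ mm K N := by
    intro p
    rw [← pow_one (mm K N), mem_pow_idealOfVars_iff']
    intro x hx
    have : x = 0 := (Finsupp.degree_eq_zero_iff x).1 (by omega)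
    subst this
    simp [constantCoeff_eq]
  induction p using MvPolynomial.induction_on with
  | C a => simp
  | add p q hp hq =>
    have := add_mem hp hq
    convert this using 1
    simp only [map_add, add_mul, Finset.sum_add_distrib]
    ring
  | mul_X p i hp =>
    have h : ∑ j, C (constantCoeff (pderiv j (p * X i))) * X j =
        C (constantCoeff p) * (X i : MvPolynomial (Fin N) K) := by
      rw [Finset.sum_eq_single i]
      · simp
      · intro j _ hj
        simp [hj.symm]
      · simp
    rw [h]
    have := Ideal.mul_mem_mul (hc p) (X_mem (K := K) i)
    rw [pow_two]
    convert this using 1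
    simp
    ring

end Anick

namespace Anick

variable {K : Type*} [Field K] {N : ℕ}

lemma chain_rule (e : MvPolynomial (Fin N) K →ₐ[K] MvPolynomial (Fin N) K) (j : Fin N)
    (p : MvPolynomial (Fin N) K) :
    pderiv j (e p) = ∑ i, e (pderiv i p) * pderiv j (e (X i)) := by
  induction p using MvPolynomial.induction_on with
  | C a => simp [algHom_C]
  | add p q hp hq => simp [hp, hq, add_mul, Finset.sum_add_distrib]
  | mul_X p l hp =>
    have h : ∀ i, e (pderiv i (p * X l)) * pderiv j (e (X i)) =
        e (X l) * (e (pderiv i p) * pderiv j (e (X i))) +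
        (if i = l then e p * pderiv j (e (X l)) else 0) := by
      intro i
      by_cases hi : i = l
      · subst hi
        simp only [pderiv_mul, pderiv_X_self, map_add, map_mul, map_one, if_true]
        ring
      · simp only [pderiv_mul, pderiv_X_of_ne (Ne.symm hi), map_add, map_mul, map_zero, if_neg hi]
        ring
    rw [Finset.sum_congr rfl (fun i _ => h i)]
    simp only [Finset.sum_add_distrib, ← Finset.mul_sum, ← hp, Finset.sum_ite_eq',
      Finset.mem_univ, if_true, map_mul, pderiv_mul]
    ring

/-- The Jacobian matrix. -/
noncomputable def jac (e : MvPolynomial (Fin N) K ≃ₐ[K] MvPolynomial (Fin N) K) :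
    Matrix (Fin N) (Fin N) (MvPolynomial (Fin N) K) :=
  Matrix.of fun i j => pderiv j (e (X i))

lemma jac_det (e : MvPolynomial (Fin N) K ≃ₐ[K] MvPolynomial (Fin N) K) :
    ∃ c : K, c ≠ 0 ∧ (jac e).det = C c := by
  have h : (Matrix.of fun l i : Fin N => e (pderiv i (e.symm (X l)))) * jac e = 1 := by
    ext1 l j
    rw [Matrix.mul_apply]
    have := chain_rule (e : MvPolynomial (Fin N) K →ₐ[K] MvPolynomial (Fin N) K) j (e.symm (X l))
    simp only [AlgEquiv.coe_toAlgHom, AlgEquiv.apply_symm_apply] at this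
    simp only [jac, Matrix.of_apply]
    rw [← this, Matrix.one_apply]
    split_ifs with h
    · subst h; simp
    · simp [h]
  have h2 : IsUnit (jac e).det := by
    have := congrArg Matrix.det h
    rw [Matrix.det_mul, Matrix.det_one, mul_comm] at this
    exact IsUnit.of_mul_eq_one _ this
  obtain ⟨c, hc, h3⟩ := isUnit_iff_eq_C_of_isReduced.1 h2
  exact ⟨c, hc.ne_zero, h3⟩

lemma prod_one_add_sub_mem {R ι : Type*} [CommRing R] (I : Ideal R) (f : ι → R) (s : Finset ι)
    (hf : ∀ i, f i ∈ I) : ∏ i ∈ s, (1 + f i) - 1 - ∑ i ∈ s, f i ∈ I ^ 2 := by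
  classical
  induction s using Finset.induction_on with
  | empty => simp
  | insert a s ha ih =>
    rw [Finset.prod_insert ha, Finset.sum_insert ha]
    have h1 := Ideal.mul_mem_left _ (1 + f a) ih
    have h2 : f a * ∑ i ∈ s, f i ∈ I ^ 2 := by
      rw [pow_two]
      exact Ideal.mul_mem_mul (hf a) (sum_mem fun i _ => hf i)
    convert add_mem h1 h2 using 1
    ring

lemma det_one_add_sub_mem {R n : Type*} [CommRing R] [Fintype n] [DecidableEq n] (I : Ideal R)
    (E : Matrix n n R) (hE : ∀ i j, E i j ∈ I) : (1 + E).det - 1 - E.trace ∈ I ^ 2 := by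
  rw [Matrix.det_apply, ← Finset.add_sum_erase _ _ (Finset.mem_univ (1 : Equiv.Perm n))]
  have h1 := prod_one_add_sub_mem I (fun i => E i i) Finset.univ (fun i => hE i i)
  have h2 : ∑ σ ∈ Finset.univ.erase (1 : Equiv.Perm n),
      Equiv.Perm.sign σ • ∏ i, (1 + E) (σ i) i ∈ I ^ 2 := by
    refine sum_mem fun σ hσ => ?_
    have hσ1 : σ ≠ 1 := (Finset.mem_erase.1 hσ).1
    obtain ⟨i, hi⟩ : ∃ i, σ i ≠ i := by
      by_contra hcon
      push Not at hcon
      exact hσ1 (Equiv.ext hcon)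
    have hj : σ (σ i) ≠ σ i := fun h => hi (σ.injective h)
    have h3 : ∏ i, (1 + E) (σ i) i ∈ I ^ 2 := by
      rw [← Finset.mul_prod_erase _ _ (Finset.mem_univ i),
        ← Finset.mul_prod_erase _ _ (Finset.mem_erase.2 ⟨hi, Finset.mem_univ (σ i)⟩), ← mul_assoc]
      refine Ideal.mul_mem_right _ _ ?_
      rw [pow_two]
      refine Ideal.mul_mem_mul ?_ ?_
      · simpa [Matrix.add_apply, Matrix.one_apply, hi] using hE (σ i) i
      · simpa [Matrix.add_apply, Matrix.one_apply, hi] using hE (σ (σ i)) (σ i)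
    rcases Int.units_eq_one_or (Equiv.Perm.sign σ) with h | h
    · rw [h, one_smul]; exact h3
    · rw [h, Units.neg_smul, one_smul]; exact neg_mem h3
  convert add_mem h1 h2 using 1
  simp only [Equiv.Perm.sign_one, one_smul, Equiv.Perm.one_apply, Matrix.add_apply,
    Matrix.one_apply_eq, Matrix.trace, Matrix.diag_apply]
  ring

/-- Fields whose degree `k` component is realised by tame automorphisms. -/
noncomputable def SS (K : Type*) [Field K] (N : ℕ) (k : ℕ) (hk : 2 ≤ k) :
    Submodule K (Fin N → MvPolynomial (Fin N) K) where
  carrier := {h | ∀ c : K, ∃ e ∈ Tame K N, ∀ i,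
    e (X i) - X i - C c * homogeneousComponent k (h i) ∈ mm K N ^ (k + 1)}
  zero_mem' := fun c => ⟨1, one_mem _, fun i => by simp⟩
  smul_mem' := by
    intro a h hh c
    obtain ⟨e, he, h1⟩ := hh (c * a)
    refine ⟨e, he, fun i => ?_⟩
    convert h1 i using 2
    simp [smul_eq_C_mul, mul_assoc]
  add_mem' := by
    intro h h' hh hh' c
    obtain ⟨e, he, h1⟩ := hh c
    obtain ⟨e', he', h1'⟩ := hh' c
    refine ⟨e * e', mul_mem he he', fun i => ?_⟩
    have hc : ∀ h : MvPolynomial (Fin N) K, C c * homogeneousComponent k h ∈ mm K N ^ k :=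
      fun h => Ideal.mul_mem_left _ _ (homog_mem (homogeneousComponent_isHomogeneous k h))
    have hsq : ∀ i, e (X i) - X i ∈ mm K N ^ 2 := by
      intro i
      have := add_mem (Ideal.pow_le_pow_right (Nat.le_succ k) (h1 i)) (hc (h i))
      rw [sub_add_cancel] at this
      exact Ideal.pow_le_pow_right hk this
    have hm := mem_of_sub_mem_sq (e : MvPolynomial (Fin N) K →ₐ[K] MvPolynomial (Fin N) K) hsq
    have a1 := map_mm_pow (e : MvPolynomial (Fin N) K →ₐ[K] MvPolynomial (Fin N) K) hm _ (h1' i)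
    have a2 := sub_mem_succ (e : MvPolynomial (Fin N) K →ₐ[K] MvPolynomial (Fin N) K) hsq _
      (hc (h' i))
    have a3 := add_mem (add_mem a1 a2) (h1 i)
    convert a3 using 1
    simp
    ring

lemma mem_SS {k : ℕ} {hk : 2 ≤ k} {h : Fin N → MvPolynomial (Fin N) K} :
    h ∈ SS K N k hk ↔ ∀ c : K, ∃ e ∈ Tame K N, ∀ i,
    e (X i) - X i - C c * homogeneousComponent k (h i) ∈ mm K N ^ (k + 1) := Iff.rfl

lemma mem_SS_of_homog {k d : ℕ} {hk : 2 ≤ k} {h : Fin N → MvPolynomial (Fin N) K}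
    (hd : ∀ i, (h i).IsHomogeneous d)
    (H : ∀ c : K, ∃ e ∈ Tame K N, ∀ i, e (X i) = X i + C c * h i) : h ∈ SS K N k hk := by
  rw [mem_SS]
  intro c
  by_cases hkd : k = d
  · subst hkd
    obtain ⟨e, he, h1⟩ := H c
    refine ⟨e, he, fun i => ?_⟩
    rw [homogeneousComponent_eq_self (hd i), h1]
    simp
  · refine ⟨1, one_mem _, fun i => ?_⟩
    rw [homogeneousComponent_of_mem (hd i), if_neg hkd]
    simp

end Anick

namespace Anick

variable {K : Type*} [Field K] {N : ℕ}

lemma monomial_mem_adjoin (α : Fin N →₀ ℕ) (i : Fin N) (hi : α i = 0) :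
    (monomial α (1 : K)) ∈ Algebra.adjoin K (X '' {j : Fin N | j ≠ i}) := by
  change _ ∈ supported K {j : Fin N | j ≠ i}
  rw [mem_supported, vars_monomial one_ne_zero]
  intro j hj h
  subst h
  simp at hj
  exact hj hi

lemma gen1 (k : ℕ) (hk : 2 ≤ k) (α : Fin N →₀ ℕ) (i : Fin N) (hi : α i = 0) :
    Pi.single i (monomial α (1 : K)) ∈ SS K N k hk := by
  refine mem_SS_of_homog (d := α.degree) ?_ ?_
  · intro l
    by_cases hl : l = i
    · subst hl
      simpa using isHomogeneous_monomial (1 : K) rfl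
    · simpa [hl] using isHomogeneous_zero _ _ _
  · intro c
    obtain ⟨e, he, h1, h2⟩ := exists_elementary i (1 : K) one_ne_zero (C c * monomial α (1 : K))
      (mul_mem (Subalgebra.algebraMap_mem _ c) (monomial_mem_adjoin α i hi))
    refine ⟨e, he, fun l => ?_⟩
    by_cases hl : l = i
    · subst hl
      simp [h1]
    · simp [hl, h2 l hl]

lemma gen2 (k : ℕ) (hk : 2 ≤ k) (γ : Fin N →₀ ℕ) (i j : Fin N) (hij : i ≠ j) (hi : γ i = 0)
    (hj : γ j = 0) (n : ℕ) (t : K) :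
    (Pi.single i (C t * (monomial γ (1 : K) * (X i + C t * X j) ^ n)) :
        Fin N → MvPolynomial (Fin N) K) -
      (Pi.single j (monomial γ (1 : K) * (X i + C t * X j) ^ n) :
        Fin N → MvPolynomial (Fin N) K) ∈ SS K N k hk := by
  have hhom : (monomial γ (1 : K) * (X i + C t * X j) ^ n).IsHomogeneous (γ.degree + 1 * n) := by
    refine (isHomogeneous_monomial (1 : K) rfl).mul (IsHomogeneous.pow ?_ n)
    refine (isHomogeneous_X K i).add ?_
    simpa using (isHomogeneous_C (Fin N) t).mul (isHomogeneous_X K j)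
  refine mem_SS_of_homog (d := γ.degree + 1 * n) ?_ ?_
  · intro l
    rw [Pi.sub_apply]
    refine IsHomogeneous.sub ?_ ?_
    · by_cases hl : l = i
      · subst hl
        simpa using (isHomogeneous_C (Fin N) t).mul hhom
      · simpa [hl] using isHomogeneous_zero _ _ _
    · by_cases hl : l = j
      · subst hl
        simpa using hhom
      · simpa [hl] using isHomogeneous_zero _ _ _
  · intro c
    have hadj : -(C c * (monomial γ (1 : K) * X i ^ n)) ∈
        Algebra.adjoin K (X '' {l : Fin N | l ≠ j}) :=
      neg_mem (mul_mem (Subalgebra.algebraMap_mem _ c) (mul_mem (monomial_mem_adjoin γ j hj)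
        (pow_mem (Algebra.subset_adjoin (Set.mem_image_of_mem X hij)) n)))
    obtain ⟨E, hE, E1, E2⟩ := exists_elementary j (1 : K) one_ne_zero _ hadj
    obtain ⟨s, hs, s1, s2⟩ := exists_elementary i (1 : K) one_ne_zero (C t * X j)
      (mul_mem (Subalgebra.algebraMap_mem _ t) (Algebra.subset_adjoin ⟨j, hij.symm, rfl⟩))
    have sC : ∀ c : K, s (C c) = C c := fun c => s.commutes c
    have EC : ∀ c : K, E (C c) = C c := fun c => E.commutes c
    have sM : s (monomial γ (1 : K)) = monomial γ (1 : K) :=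
      fix_of_supported (monomial_mem_adjoin γ i hi)
        (s : MvPolynomial (Fin N) K →ₐ[K] MvPolynomial (Fin N) K) s2
    have hinv : ∀ p q, s p = q → s⁻¹ q = p := by
      rintro p _ rfl
      exact s.symm_apply_apply p
    simp only [C_1, one_mul] at s1 E1
    have i1 : s⁻¹ (X i) = X i - C t * X j := by
      apply hinv
      rw [map_sub, map_mul, sC, s1, s2 j hij.symm]
      ring
    have i2 : ∀ l, l ≠ i → s⁻¹ (X l) = X l := fun l hl => hinv _ _ (s2 l hl)
    refine ⟨s * E * s⁻¹, mul_mem (mul_mem hs hE) (inv_mem hs), fun l => ?_⟩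
    simp only [AlgEquiv.mul_apply, Pi.sub_apply]
    by_cases hl : l = i
    · subst hl
      rw [i1, Pi.single_eq_same, Pi.single_eq_of_ne hij]
      simp only [map_sub, map_mul, map_add, map_neg, map_pow, EC, sC, E1, E2 l hij, s1,
        s2 j hij.symm, sM]
      ring
    · rw [i2 l hl, Pi.single_eq_of_ne hl]
      by_cases hl' : l = j
      · subst hl'
        rw [Pi.single_eq_same]
        simp only [map_sub, map_mul, map_add, map_neg, map_pow, sC, E1, s1,
          s2 l hl, sM]
        ring
      · rw [Pi.single_eq_of_ne hl', E2 l hl', s2 l hl]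
        simp

lemma expand (γ : Fin N →₀ ℕ) (i j : Fin N) (n : ℕ) (t : K) :
    monomial γ (1 : K) * (X i + C t * X j) ^ n = ∑ r ∈ Finset.range (n + 1),
      (t ^ r * (n.choose r : K)) •
        monomial (γ + Finsupp.single i (n - r) + Finsupp.single j r) (1 : K) := by
  rw [add_comm (X i), add_pow, Finset.mul_sum]
  refine Finset.sum_congr rfl fun r _ => ?_
  rw [smul_eq_C_mul, monomial_add_single, monomial_add_single, mul_pow, C_mul, C_pow]
  simp
  ring

lemma pair [CharZero K] (k : ℕ) (hk : 2 ≤ k) (f : (Fin N → MvPolynomial (Fin N) K) →ₗ[K] K)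
    (hf : ∀ h ∈ SS K N k hk, f h = 0) (β : Fin N →₀ ℕ) (i j : Fin N) (hij : i ≠ j) :
    ((β j : K) + 1) * f (Pi.single i (monomial (β + Finsupp.single i 1) (1 : K))) =
    ((β i : K) + 1) * f (Pi.single j (monomial (β + Finsupp.single j 1) (1 : K))) := by
  set a := β i with ha
  set b := β j with hb
  set γ := (β.erase i).erase j with hγ
  have hγi : γ i = 0 := by simp [hγ, Finsupp.erase_ne hij]
  have hγj : γ j = 0 := by simp [hγ]
  set n := a + b + 1 with hn
  set A : ℕ → K := fun r => f (Pi.single i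
    (monomial (γ + Finsupp.single i (n - r) + Finsupp.single j r) (1 : K))) with hA
  set B : ℕ → K := fun r => f (Pi.single j
    (monomial (γ + Finsupp.single i (n - r) + Finsupp.single j r) (1 : K))) with hB
  have single_lin : ∀ (l : Fin N) (p : MvPolynomial (Fin N) K),
      f (Pi.single l p) = (f ∘ₗ LinearMap.single K (fun _ => MvPolynomial (Fin N) K) l) p :=
    fun l p => rfl
  let P : Polynomial K := ∑ r ∈ Finset.range (n + 1),
    (Polynomial.C ((n.choose r : K) * A r) * Polynomial.X ^ (r + 1) -
      Polynomial.C ((n.choose r : K) * B r) * Polynomial.X ^ r)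
  have hP : P = 0 := by
    apply Polynomial.funext
    intro t
    have h1 := hf _ (gen2 k hk γ i j hij hγi hγj n t)
    rw [map_sub, single_lin, single_lin, expand, ← smul_eq_C_mul, map_smul, map_sum, map_sum,
      smul_eq_mul, Finset.mul_sum, ← Finset.sum_sub_distrib] at h1
    rw [Polynomial.eval_zero, ← h1, Polynomial.eval_finsetSum]
    refine Finset.sum_congr rfl fun r _ => ?_
    simp only [map_smul, smul_eq_mul, single_lin, Polynomial.eval_sub, Polynomial.eval_mul,
      Polynomial.eval_C, Polynomial.eval_pow, Polynomial.eval_X, hA, hB]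
    ring
  have hco := congrArg (fun p => Polynomial.coeff p (b + 1)) hP
  simp only [P, Polynomial.finsetSum_coeff, Polynomial.coeff_sub, Polynomial.coeff_C_mul,
    Polynomial.coeff_X_pow, Polynomial.coeff_zero, Finset.sum_sub_distrib, mul_ite, mul_one,
    mul_zero, add_left_inj, Finset.sum_ite_eq, Finset.mem_range] at hco
  rw [if_pos (by omega), if_pos (by omega)] at hco
  have eA : γ + Finsupp.single i (n - b) + Finsupp.single j b = β + Finsupp.single i 1 := by
    ext l
    by_cases hl : l = i
    · subst hl
      simp [hγi, hij.symm, hij]; omega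
    · by_cases hl' : l = j
      · subst hl'
        simp [hγj, hij]; omega
      · simp [hγ, hl, hl', Finsupp.erase_ne, Ne.symm hl, Ne.symm hl']
  have eB : γ + Finsupp.single i (n - (b + 1)) + Finsupp.single j (b + 1) =
      β + Finsupp.single j 1 := by
    ext l
    by_cases hl : l = i
    · subst hl
      simp [hγi, hij.symm, hij]; omega
    · by_cases hl' : l = j
      · subst hl'
        simp [hγj, hij]; omega
      · simp [hγ, hl, hl', Finsupp.erase_ne, Ne.symm hl, Ne.symm hl']
  simp only [hA, hB, eA, eB] at hco
  have hch : (n.choose (b + 1) : K) * ((b : K) + 1) = (n.choose b : K) * ((a : K) + 1) := by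
    have := Nat.choose_succ_right_eq n b
    rw [show n - b = a + 1 by omega] at this
    exact_mod_cast this
  have hne : (n.choose b : K) ≠ 0 := by
    exact_mod_cast (Nat.choose_pos (by omega)).ne'
  apply mul_left_cancel₀ hne
  linear_combination ((b : K) + 1) * hco +
    f (Pi.single j (monomial (β + Finsupp.single j 1) (1 : K))) * hch

lemma div_free_mem [CharZero K] (k : ℕ) (hk : 2 ≤ k) (hN : 1 ≤ N)
    (h : Fin N → MvPolynomial (Fin N) K) (hdiv : ∑ i, pderiv i (h i) = 0) :
    h ∈ SS K N k hk := by
  by_contra hcon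
  obtain ⟨f, hfh, hf⟩ := Submodule.exists_le_ker_of_notMem hcon
  have hf' : ∀ h ∈ SS K N k hk, f h = 0 := fun h hh => hf hh
  apply hfh
  let i0 : Fin N := ⟨0, hN⟩
  let G : MvPolynomial (Fin N) K →ₗ[K] K := (basisMonomials (Fin N) K).constr K
    fun β => ((β i0 : K) + 1)⁻¹ * f (Pi.single i0 (monomial (β + Finsupp.single i0 1) (1 : K)))
  have hG : ∀ β, G (monomial β 1) =
      ((β i0 : K) + 1)⁻¹ * f (Pi.single i0 (monomial (β + Finsupp.single i0 1) (1 : K))) := by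
    intro β
    have := (basisMonomials (Fin N) K).constr_basis K (fun β => ((β i0 : K) + 1)⁻¹ *
      f (Pi.single i0 (monomial (β + Finsupp.single i0 1) (1 : K)))) β
    simpa using this
  have key : ∀ i, f ∘ₗ LinearMap.single K (fun _ => MvPolynomial (Fin N) K) i =
      G ∘ₗ (pderiv i : Derivation K (MvPolynomial (Fin N) K) _).toLinearMap := by
    intro i
    apply (basisMonomials (Fin N) K).ext
    intro α
    simp only [coe_basisMonomials, LinearMap.comp_apply, LinearMap.single_apply,
      Derivation.coeFn_coe, pderiv_monomial, one_mul]
    by_cases hα : α i = 0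
    · rw [hα, hf' _ (gen1 k hk α i hα)]
      simp
    · obtain ⟨β, rfl⟩ : ∃ β, α = β + Finsupp.single i 1 :=
        ⟨α - Finsupp.single i 1, by
          ext l
          by_cases hl : l = i
          · subst hl; simp; omega
          · simp [Finsupp.single_apply, Ne.symm hl]⟩
      have hm : monomial (β + Finsupp.single i 1 - Finsupp.single i 1)
          (((β + Finsupp.single i 1 : Fin N →₀ ℕ) i : ℕ) : K) = ((β i : K) + 1) • monomial β (1 : K) := by
        rw [add_tsub_cancel_right, smul_monomial]
        simp
      rw [hm, map_smul, hG, smul_eq_mul]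
      have hne : ((β i0 : K) + 1) ≠ 0 := Nat.cast_add_one_ne_zero _
      by_cases hi : i = i0
      · subst hi
        field_simp
      · have := pair k hk f hf' β i i0 hi
        field_simp
        linear_combination this
  have : f h = G (∑ i, pderiv i (h i)) := by
    conv_lhs => rw [← Finset.univ_sum_single h]
    rw [map_sum, map_sum]
    exact Finset.sum_congr rfl fun i _ => LinearMap.congr_fun (key i) (h i)
  rw [this, hdiv, map_zero]

lemma step [CharZero K] (k : ℕ) (hk : 2 ≤ k) (hN : 1 ≤ N)
    (χ : MvPolynomial (Fin N) K ≃ₐ[K] MvPolynomial (Fin N) K)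
    (hχ : ∀ i, χ (X i) - X i ∈ mm K N ^ k) :
    ∃ τ ∈ Tame K N, ∀ i, (τ * χ) (X i) - X i ∈ mm K N ^ (k + 1) := by
  obtain ⟨l, rfl⟩ : ∃ l, k = l + 1 := ⟨k - 1, by omega⟩
  let E : Matrix (Fin N) (Fin N) (MvPolynomial (Fin N) K) :=
    Matrix.of fun i j => pderiv j (χ (X i) - X i)
  have hE : ∀ i j, E i j ∈ mm K N ^ l := fun i j => pderiv_mem j l (hχ i)
  have hJ : jac χ = 1 + E := by
    ext1 i j
    simp only [jac, E, Matrix.of_apply, Matrix.add_apply, map_sub, Matrix.one_apply]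
    split_ifs with h
    · subst h; simp
    · simp [h]
  obtain ⟨c, hc, hdet⟩ := jac_det χ
  have h1 := det_one_add_sub_mem (mm K N ^ l) E hE
  rw [← hJ, hdet, ← pow_mul] at h1
  have h1' : C c - 1 - E.trace ∈ mm K N ^ (l + 1) := Ideal.pow_le_pow_right (by omega) h1
  have htr : E.trace ∈ mm K N ^ l := sum_mem fun i _ => hE i i
  have hc1 : c - 1 = 0 := by
    have h2 : C (c - 1) ∈ mm K N ^ l := by
      have := add_mem (Ideal.pow_le_pow_right (Nat.le_succ l) h1') htr
      simpa using this
    rcases (C_mem_pow_idealOfVars_iff l (c - 1)).1 h2 with h | h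
    · exact h
    · omega
  have htr' : E.trace ∈ mm K N ^ (l + 1) := by
    have hC : (C c : MvPolynomial (Fin N) K) = 1 := by rw [sub_eq_zero.1 hc1, C_1]
    rw [hC, sub_self, zero_sub] at h1'
    simpa using neg_mem h1'
  let h : Fin N → MvPolynomial (Fin N) K := fun i => homogeneousComponent (l + 1) (χ (X i) - X i)
  have hh : ∀ i, (h i).IsHomogeneous (l + 1) := fun i => homogeneousComponent_isHomogeneous _ _
  have hrest : ∀ i, χ (X i) - X i - h i ∈ mm K N ^ (l + 1 + 1) := fun i => sub_homog_mem (hχ i)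
  have hdiv : ∑ i, pderiv i (h i) = 0 := by
    refine homog_eq_zero (k := l) (IsHomogeneous.sum _ _ _ fun i _ => (hh i).pderiv) ?_
    have h3 : ∑ i, pderiv i (χ (X i) - X i - h i) ∈ mm K N ^ (l + 1) :=
      sum_mem fun i _ => pderiv_mem i _ (hrest i)
    have h4 := sub_mem htr' h3
    convert h4 using 1
    simp only [Matrix.trace, Matrix.diag_apply, E, Matrix.of_apply, ← Finset.sum_sub_distrib,
      ← map_sub, sub_sub_cancel]
  obtain ⟨τ, hτ, ht⟩ := (mem_SS.1 (div_free_mem (l + 1) hk hN h hdiv)) (-1)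
  refine ⟨τ, hτ, fun i => ?_⟩
  have ht' : ∀ i, τ (X i) - X i + h i ∈ mm K N ^ (l + 1 + 1) := by
    intro i
    have := ht i
    rw [homogeneousComponent_eq_self (hh i)] at this
    simpa using this
  have hsq : ∀ i, τ (X i) - X i ∈ mm K N ^ 2 := by
    intro i
    have := sub_mem (Ideal.pow_le_pow_right (Nat.le_succ _) (ht' i)) (homog_mem (hh i))
    rw [add_sub_cancel_right] at this
    exact Ideal.pow_le_pow_right hk this
  have hm := mem_of_sub_mem_sq (τ : MvPolynomial (Fin N) K →ₐ[K] MvPolynomial (Fin N) K) hsq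
  have a1 := map_mm_pow (τ : MvPolynomial (Fin N) K →ₐ[K] MvPolynomial (Fin N) K) hm _ (hrest i)
  have a2 := sub_mem_succ (τ : MvPolynomial (Fin N) K →ₐ[K] MvPolynomial (Fin N) K) hsq _
      (homog_mem (hh i))
  convert add_mem (add_mem a1 a2) (ht' i) using 1
  simp

lemma base1 (φ : MvPolynomial (Fin N) K ≃ₐ[K] MvPolynomial (Fin N) K) :
    ∃ τ ∈ Tame K N, ∀ i, constantCoeff ((τ * φ) (X i)) = 0 := by
  obtain ⟨τ, hτ, h⟩ := exists_translation fun i => constantCoeff (φ.symm (X i))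
  refine ⟨τ, hτ, fun i => ?_⟩
  have key : ∀ q, constantCoeff (τ q) = constantCoeff (φ.symm q) := by
    intro q
    induction q using MvPolynomial.induction_on with
    | C a =>
      rw [show τ (C a) = C a from τ.commutes a, show φ.symm (C a) = C a from φ.symm.commutes a]
    | add p q hp hq => simp [hp, hq]
    | mul_X p i hp => rw [map_mul, map_mul, map_mul, map_mul, hp, h]; simp
  rw [AlgEquiv.mul_apply, key]
  simp

lemma base2 (χ : MvPolynomial (Fin N) K ≃ₐ[K] MvPolynomial (Fin N) K)
    (hχ : ∀ i, constantCoeff (χ (X i)) = 0) :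
    ∃ τ ∈ Tame K N, ∀ i, (τ * χ) (X i) - X i ∈ mm K N ^ 2 := by
  let A : Matrix (Fin N) (Fin N) K := (jac χ).map constantCoeff
  obtain ⟨c, hc, hdet⟩ := jac_det χ
  have hA : A.det = c := by
    have := RingHom.map_det (constantCoeff (R := K) (σ := Fin N)) (jac χ)
    rw [hdet, constantCoeff_C] at this
    exact this.symm
  have hAu : IsUnit A.det := by rw [hA]; exact hc.isUnit
  obtain ⟨τ, hτ, h⟩ := linTame_of_det A⁻¹ (Matrix.isUnit_nonsing_inv_det A hAu).ne_zero
  refine ⟨τ, hτ, fun i => ?_⟩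
  have hm : ∀ i, τ (X i) ∈ mm K N := by
    intro i
    rw [h]
    exact sum_mem fun j _ => Ideal.mul_mem_left _ _ (X_mem j)
  have h1 := taylor (χ (X i))
  rw [hχ, C_0, sub_zero] at h1
  have h2 := map_mm_pow (τ : MvPolynomial (Fin N) K →ₐ[K] MvPolynomial (Fin N) K) hm _ h1
  convert h2 using 1
  rw [AlgEquiv.coe_toAlgHom, map_sub, AlgEquiv.mul_apply]
  congr 1
  have hAi : A * A⁻¹ = 1 := Matrix.mul_nonsing_inv A hAu
  have tC : ∀ c : K, τ (C c) = C c := fun c => τ.commutes c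
  have : ∀ j, C (constantCoeff (pderiv j (χ (X i)))) = (C (A i j) : MvPolynomial (Fin N) K) :=
    fun j => rfl
  simp only [map_sum, map_mul, this, tC, h, Finset.mul_sum]
  rw [Finset.sum_comm]
  have h5 : ∀ l, ∑ j, C (A i j) * (C (A⁻¹ j l) * X l) =
      C ((1 : Matrix (Fin N) (Fin N) K) i l) * (X l : MvPolynomial (Fin N) K) := by
    intro l
    rw [← hAi, Matrix.mul_apply, map_sum, Finset.sum_mul]
    simp [mul_assoc]
  simp [h5, Matrix.one_apply, apply_ite (C (σ := Fin N) (R := K))]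

lemma approx_all [CharZero K] (hN : 1 ≤ N) (φ : MvPolynomial (Fin N) K ≃ₐ[K] MvPolynomial (Fin N) K)
    (k : ℕ) : ∃ τ ∈ Tame K N, ∀ i, (τ * φ) (X i) - X i ∈ mm K N ^ (k + 2) := by
  induction k with
  | zero =>
    obtain ⟨τ, hτ, h⟩ := base1 φ
    obtain ⟨σ, hσ, h'⟩ := base2 (τ * φ) h
    exact ⟨σ * τ, mul_mem hσ hτ, by simpa only [mul_assoc] using h'⟩
  | succ k ih =>
    obtain ⟨τ, hτ, h⟩ := ih
    obtain ⟨σ, hσ, h'⟩ := step (k + 2) (by omega) hN (τ * φ) h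
    exact ⟨σ * τ, mul_mem hσ hτ, by simpa only [mul_assoc] using h'⟩

end Anick

/-- **Anick's tame approximation theorem.** Let `K` be a field of characteristic zero
and let `φ` be an automorphism of `K[x_1,…,x_N]` with Jacobian determinant `1`. Then
for every `k` there is a tame automorphism `ψ` (in the subgroup generated by elementary
automorphisms) such that `(ψ⁻¹ ∘ φ)(x_i) − x_i` has height `≥ k` for every `i`. -/
theorem anick_tame_approximation (K : Type*) [Field K] [CharZero K] (N : ℕ)
    (hN : 1 ≤ N)
    (φ : MvPolynomial (Fin N) K ≃ₐ[K] MvPolynomial (Fin N) K)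
    (hJ : Matrix.det (Matrix.of fun i j : Fin N =>
      MvPolynomial.pderiv j (φ (MvPolynomial.X i))) = 1) :
    ∀ k : ℕ,
      ∃ ψ ∈ Subgroup.closure {e : MvPolynomial (Fin N) K ≃ₐ[K] MvPolynomial (Fin N) K |
          IsElementaryAut e},
        ∀ i : Fin N,
          HeightGE ((ψ⁻¹ * φ) (MvPolynomial.X i) - MvPolynomial.X i) k := by
  intro k
  obtain ⟨τ, hτ, h⟩ := Anick.approx_all hN φ k
  refine ⟨τ⁻¹, inv_mem hτ, fun i => ?_⟩
  rw [Anick.heightGE_iff, inv_inv]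
  exact Ideal.pow_le_pow_right (by omega) (h i)
end

section
/- Symplectic irreducibility lemma: let K be a field of characteristic zero, n ≥ 1, d ≥ 0, and let A_d ⊆ K[x_1,…,x_n,p_1,…,p_n] be the K-subspace of homogeneous polynomials of total degree d. Suppose V is a K-subspace of A_d such that for every symplectic matrix S ∈ Sp(2n,K), the linear substitution automorphism ρ_S (the algebra map sending each generator ξ_i to Σ_j S_{ij} ξ_j) maps V into V. Then V = 0 or V = A_d. -/
open MvPolynomial

/-- A symplectic transvection `1 + t (J u) uᵀ` is symplectic. -/
theorem transvection_mem {K : Type*} [Field K] {n : ℕ} (u : Fin n ⊕ Fin n → K) (t : K) :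
    (1 + t • Matrix.vecMulVec ((Matrix.J (Fin n) K).mulVec u) u) ∈
      Matrix.symplecticGroup (Fin n) K := by
  rw [SymplecticGroup.mem_iff]
  have hJ : Matrix.vecMul u (Matrix.J (Fin n) K) = -((Matrix.J (Fin n) K).mulVec u) := by
    rw [← Matrix.mulVec_transpose, Matrix.J_transpose, Matrix.neg_mulVec]
  have h0 : ((Matrix.J (Fin n) K).mulVec u) ⬝ᵥ u = 0 := by
    simp [Matrix.J, Matrix.mulVec, dotProduct, Matrix.fromBlocks, Matrix.one_apply, mul_comm]
  rw [Matrix.transpose_add, Matrix.transpose_one, Matrix.transpose_smul,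
    Matrix.transpose_vecMulVec, Matrix.add_mul, Matrix.one_mul, Matrix.smul_mul,
    Matrix.vecMulVec_mul, hJ, Matrix.mul_add, Matrix.mul_one, Matrix.add_mul, Matrix.mul_smul,
    Matrix.mul_vecMulVec, Matrix.smul_mul, Matrix.mul_smul, Matrix.vecMulVec_mul_vecMulVec,
    Matrix.vecMulVec_neg]
  simp [h0]

/-- Homogeneous polynomials scale under substitution. -/
theorem aeval_scale {K σ A : Type*} [Field K] [CommRing A] [Algebra K A] {d : ℕ}
    {f : MvPolynomial σ K} (hf : f.IsHomogeneous d) (s : K) (y : σ → A) :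
    aeval (fun i => s • y i) f = s ^ d • aeval y f := by
  rw [aeval_def, aeval_def, eval₂_eq, eval₂_eq, Finset.smul_sum]
  refine Finset.sum_congr rfl fun m hm => ?_
  have hd : ∑ i ∈ m.support, m i = d := by
    have := hf (mem_support_iff.mp hm)
    rw [Finsupp.weight_apply] at this
    simpa [Finsupp.sum] using this
  simp only [smul_pow]
  rw [Finset.prod_smul, Finset.prod_pow_eq_pow_sum, hd, mul_smul_comm]

/-- If a linear functional kills `f (s y + z)` for `s ≠ 0`, it kills `f z`. -/
theorem limit_zero {K σ A : Type*} [Field K] [Infinite K] [CommRing A] [Algebra K A]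
    (f : MvPolynomial σ K) (φ : A →ₗ[K] K) (y z : σ → A)
    (h : ∀ s : K, s ≠ 0 → φ (aeval (fun i => s • y i + z i) f) = 0) :
    φ (aeval z f) = 0 := by
  let G : Polynomial A := aeval (fun i => Polynomial.X * Polynomial.C (y i) + Polynomial.C (z i)) f
  let q : Polynomial K := ∑ k ∈ Finset.range (G.natDegree + 1),
    Polynomial.C (φ (G.coeff k)) * Polynomial.X ^ k
  have hG : ∀ s : K, G.eval (algebraMap K A s) = aeval (fun i => s • y i + z i) f := by
    intro s
    have : ∀ g : MvPolynomial σ K, ((Polynomial.aeval (algebraMap K A s) : Polynomial A →ₐ[A] A).restrictScalars K)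
        (aeval (fun i => Polynomial.X * Polynomial.C (y i) + Polynomial.C (z i)) g) =
        aeval (fun i => s • y i + z i) g := by
      intro g
      rw [← AlgHom.comp_apply]
      congr 1
      ext i
      simp [Algebra.smul_def]
      exact mul_comm _ _
    have h2 := this f
    rw [AlgHom.restrictScalars_apply, Polynomial.coe_aeval_eq_eval] at h2
    exact h2
  have hq : ∀ s : K, q.eval s = φ (aeval (fun i => s • y i + z i) f) := by
    intro s
    rw [← hG, Polynomial.eval_eq_sum_range (p := G), map_sum, Polynomial.eval_finsetSum]
    refine Finset.sum_congr rfl fun k _ => ?_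
    rw [← map_pow, mul_comm (G.coeff k), ← Algebra.smul_def, map_smul, Polynomial.eval_mul, Polynomial.eval_C, Polynomial.eval_pow,
      Polynomial.eval_X, smul_eq_mul]
    exact mul_comm _ _
  have hz : Polynomial.X * q = 0 := by
    apply Polynomial.funext
    intro s
    by_cases hs : s = 0
    · simp [hs]
    · simp [hq, h s hs]
  have hq0 : q = 0 := by
    rcases mul_eq_zero.mp hz with h | h
    · exact absurd h Polynomial.X_ne_zero
    · exact h
  have := hq 0
  simpa [hq0] using this.symm

/-- Linear functionals on powers of linear forms are polynomial in the coefficients. -/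
theorem power_poly {K σ : Type*} [Field K] [CharZero K] [Fintype σ] [DecidableEq σ] (d : ℕ)
    (φ : MvPolynomial σ K →ₗ[K] K) :
    ∃ Q : MvPolynomial σ K, (∀ u : σ → K, eval u Q = φ ((∑ j, u j • X j) ^ d)) ∧
      (Q = 0 → ∀ m : σ →₀ ℕ, m.degree = d → φ (monomial m 1) = 0) := by
  refine ⟨∑ k ∈ Finset.piAntidiag Finset.univ d,
    monomial (Finsupp.equivFunOnFinite.symm k)
      ((Nat.multinomial Finset.univ k : K) * φ (∏ i, X i ^ k i)), ?_, ?_⟩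
  · intro u
    rw [Finset.sum_pow_eq_sum_piAntidiag, map_sum, map_sum]
    refine Finset.sum_congr rfl fun k _ => ?_
    simp only [smul_pow]
    rw [Finset.prod_smul, mul_smul_comm, map_smul, eval_monomial,
      Finsupp.prod_fintype _ _ (by simp), ← nsmul_eq_mul (_ : ℕ) (∏ i, X i ^ k i), map_nsmul]
    simp [mul_comm]
  · intro hQ m hm
    have h := congrArg (coeff m) hQ
    rw [coeff_sum, Finset.sum_eq_single (m : σ → ℕ)] at h
    · simp only [coeff_monomial, coeff_zero] at h
      rw [if_pos (by ext; simp)] at h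
      have hne : (Nat.multinomial Finset.univ (m : σ → ℕ) : K) ≠ 0 :=
        Nat.cast_ne_zero.mpr (Nat.multinomial_pos _ _).ne'
      rcases mul_eq_zero.mp h with h | h
      · exact absurd h hne
      · rw [monomial_eq, Finsupp.prod_fintype _ _ (by simp)]
        simpa using h
    · intro k _ hk
      rw [coeff_monomial, if_neg]
      rintro rfl
      exact hk (by ext; simp)
    · intro hnot
      exfalso
      apply hnot
      simp [Finset.mem_piAntidiag, ← hm, Finsupp.degree_eq_sum]

/-- **Symplectic irreducibility lemma.** Let `K` have characteristic zero and let `V`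
be a subspace of the space `A_d` of homogeneous polynomials of degree `d` in
`K[x_1,…,x_n,p_1,…,p_n]`. If `V` is invariant under the linear substitution
automorphisms `ρ_S` for all symplectic matrices `S ∈ Sp(2n,K)`, then `V = 0` or
`V = A_d`. -/
theorem symplectic_irreducibility (K : Type*) [Field K] [CharZero K] (n : ℕ)
    (hn : 1 ≤ n) (d : ℕ)
    (V : Submodule K (MvPolynomial (Fin n ⊕ Fin n) K))
    (hVd : V ≤ MvPolynomial.homogeneousSubmodule (Fin n ⊕ Fin n) K d)
    (hinv : ∀ S : Matrix (Fin n ⊕ Fin n) (Fin n ⊕ Fin n) K,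
      S ∈ Matrix.symplecticGroup (Fin n) K →
      ∀ v ∈ V, MvPolynomial.aeval (fun i : Fin n ⊕ Fin n =>
        ∑ j : Fin n ⊕ Fin n, S i j • MvPolynomial.X j) v ∈ V) :
    V = ⊥ ∨ V = MvPolynomial.homogeneousSubmodule (Fin n ⊕ Fin n) K d := by
  classical
  by_cases hV : V = ⊥
  · exact Or.inl hV
  right
  obtain ⟨f, hfV, hf0⟩ := V.ne_bot_iff.mp hV
  have hfd : f.IsHomogeneous d := (mem_homogeneousSubmodule _ _).mp (hVd hfV)
  refine le_antisymm hVd fun g hg => ?_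
  by_contra hgV
  obtain ⟨φ, hφg, hφV⟩ := Submodule.exists_le_ker_of_notMem hgV
  apply hφg
  have hkey : ∀ u : Fin n ⊕ Fin n → K,
      eval ((Matrix.J (Fin n) K).mulVec u) f * φ ((∑ j, u j • X j) ^ d) = 0 := by
    intro u
    set c := (Matrix.J (Fin n) K).mulVec u with hc
    have h1 := limit_zero f φ X (fun i => c i • ∑ j, u j • X j) (by
      intro s hs
      have h2 := hφV (hinv _ (transvection_mem u s⁻¹) f hfV)
      rw [LinearMap.mem_ker] at h2
      have h3 : (fun i => s • (X i : MvPolynomial (Fin n ⊕ Fin n) K) + c i • ∑ j, u j • X j) =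
          fun i => s • (∑ j, ((1 + s⁻¹ • Matrix.vecMulVec c u :
            Matrix (Fin n ⊕ Fin n) (Fin n ⊕ Fin n) K) i j) •
            (X j : MvPolynomial (Fin n ⊕ Fin n) K)) := by
        funext i
        simp only [Matrix.add_apply, Matrix.smul_apply, Matrix.vecMulVec_apply, add_smul,
          Finset.sum_add_distrib, smul_add, Finset.smul_sum, smul_smul, smul_eq_mul,
          Matrix.one_apply, ite_smul, one_smul, zero_smul,
          Finset.sum_ite_eq, Finset.mem_univ, if_true, mul_inv_cancel_left₀ hs]
      rw [h3, aeval_scale hfd, map_smul, h2, smul_zero])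
    have h4 : aeval (fun i => c i • ∑ j, u j • (X j : MvPolynomial (Fin n ⊕ Fin n) K)) f =
        eval c f • (∑ j, u j • (X j : MvPolynomial (Fin n ⊕ Fin n) K)) ^ d := by
      generalize (∑ j, u j • (X j : MvPolynomial (Fin n ⊕ Fin n) K)) = L
      rw [aeval_def, eval₂_eq, eval_eq, Finset.sum_smul]
      refine Finset.sum_congr rfl fun m hm => ?_
      have hd : ∑ i ∈ m.support, m i = d := by
        have := hfd (mem_support_iff.mp hm)
        rw [Finsupp.weight_apply] at this
        simpa [Finsupp.sum] using this
      simp only [smul_pow]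
      rw [Finset.prod_smul, Finset.prod_pow_eq_pow_sum, hd, mul_smul_comm, ← Algebra.smul_def,
        smul_smul, mul_comm]
    rw [h4, map_smul, smul_eq_mul] at h1
    exact h1
  obtain ⟨Q, hQ, hQ0⟩ := power_poly d φ
  let F : MvPolynomial (Fin n ⊕ Fin n) K :=
    aeval (fun i => ∑ j, C (Matrix.J (Fin n) K i j) * X j) f
  have hF : ∀ u, eval u F = eval ((Matrix.J (Fin n) K).mulVec u) f := by
    intro u
    have h5 : ∀ g : MvPolynomial (Fin n ⊕ Fin n) K,
        aeval u (aeval (fun i => ∑ j, C (Matrix.J (Fin n) K i j) * X j) g) =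
        aeval ((Matrix.J (Fin n) K).mulVec u) g := by
      intro g
      rw [← AlgHom.comp_apply]
      congr 1
      ext i
      simp [Matrix.mulVec, dotProduct]
    have h6 := h5 f
    rw [aeval_eq_eval, aeval_eq_eval] at h6
    exact h6
  have hFQ : F * Q = 0 := by
    apply MvPolynomial.funext
    intro u
    rw [map_mul, hF, hQ, hkey, map_zero]
  have hF0 : F ≠ 0 := by
    intro h
    apply hf0
    apply MvPolynomial.funext
    intro v
    have h6 := hF (-((Matrix.J (Fin n) K).mulVec v))
    rw [Matrix.mulVec_neg, Matrix.mulVec_mulVec, Matrix.J_squared, Matrix.neg_mulVec,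
      Matrix.one_mulVec, neg_neg, h] at h6
    rw [← h6, map_zero, map_zero]
  have hφ := hQ0 ((mul_eq_zero.mp hFQ).resolve_left hF0)
  have hgd : g.IsHomogeneous d := (mem_homogeneousSubmodule _ _).mp hg
  rw [g.as_sum, map_sum]
  refine Finset.sum_eq_zero fun m hm => ?_
  have hmd : m.degree = d := by
    have := hgd (mem_support_iff.mp hm)
    rw [Finsupp.degree_eq_weight_one]
    exact this
  have h7 : monomial m (coeff m g) = coeff m g • (monomial m 1 : MvPolynomial (Fin n ⊕ Fin n) K) := by
    rw [smul_monomial, smul_eq_mul, mul_one]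
  rw [h7, map_smul, hφ m hmd, smul_zero]
end

section
/- Commutators of augmentation subgroups: let K be a field, n ≥ 1, and let I = (x_1,…,x_n) be the augmentation ideal of K[x_1,…,x_n]. For N ≥ 2 let H_N denote the set of K-algebra automorphisms φ of K[x_1,…,x_n] with φ(x_i) − x_i ∈ I^N for all i. Then for all m, k ≥ 2 and all ψ_1 ∈ H_m, ψ_2 ∈ H_k, the commutator ψ_1^{-1}∘ψ_2^{-1}∘ψ_1∘ψ_2 belongs to H_{m+k−1}. -/
open MvPolynomial


section helpers
variable {K : Type*} [Field K] {n : ℕ}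

/-- The augmentation ideal. -/
noncomputable def augI (K : Type*) [Field K] (n : ℕ) : Ideal (MvPolynomial (Fin n) K) :=
  Ideal.span (Set.range (X : Fin n → MvPolynomial (Fin n) K))

lemma sub_mem_all (A : MvPolynomial (Fin n) K ≃ₐ[K] MvPolynomial (Fin n) K)
    (J : Ideal (MvPolynomial (Fin n) K)) (h : ∀ i, A (X i) - X i ∈ J)
    (f : MvPolynomial (Fin n) K) : A f - f ∈ J := by
  have e : (Ideal.Quotient.mkₐ K J).comp (A : _ →ₐ[K] _) = Ideal.Quotient.mkₐ K J := by
    apply MvPolynomial.algHom_ext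
    intro i
    exact Ideal.Quotient.eq.2 (h i)
  exact Ideal.Quotient.eq.1 (DFunLike.congr_fun e f)

lemma map_mem_aug (A : MvPolynomial (Fin n) K ≃ₐ[K] MvPolynomial (Fin n) K)
    (m : ℕ) (h : ∀ i, A (X i) - X i ∈ augI K n ^ (m + 1))
    (f : MvPolynomial (Fin n) K) : A f ∈ augI K n ↔ f ∈ augI K n := by
  have := sub_mem_all A (augI K n) (fun i => Ideal.pow_le_self (Nat.succ_ne_zero m) (h i)) f
  constructor
  · intro hf
    simpa using Ideal.sub_mem _ hf this
  · intro hf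
    simpa using Ideal.add_mem _ this hf

lemma symm_mem_pow (A : MvPolynomial (Fin n) K ≃ₐ[K] MvPolynomial (Fin n) K)
    (m : ℕ) (h : ∀ i, A (X i) - X i ∈ augI K n ^ (m + 1)) (N : ℕ)
    (f : MvPolynomial (Fin n) K) (hf : f ∈ augI K n ^ N) : A⁻¹ f ∈ augI K n ^ N := by
  have h1 : augI K n ≤ (augI K n).comap (A⁻¹ : _ ≃ₐ[K] _) := by
    intro g hg
    rw [Ideal.mem_comap, ← map_mem_aug A m h]
    have : A (A⁻¹ g) = g := A.apply_symm_apply g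
    rwa [this]
  exact (Ideal.pow_right_mono h1 N).trans (Ideal.le_comap_pow _ N) hf

lemma sub_mem_pow (A : MvPolynomial (Fin n) K ≃ₐ[K] MvPolynomial (Fin n) K)
    (m : ℕ) (h : ∀ i, A (X i) - X i ∈ augI K n ^ (m + 1)) (j : ℕ) :
    ∀ f ∈ augI K n ^ j, A f - f ∈ augI K n ^ (j + m) := by
  induction j with
  | zero =>
    intro f _
    rw [zero_add]
    exact Ideal.pow_le_pow_right (Nat.le_succ m) (sub_mem_all A _ h f)
  | succ j ih =>
    intro f hf
    rw [pow_succ] at hf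
    induction hf using Submodule.mul_induction_on' with
    | mem_mul_mem g hg t ht =>
      have e : A (g * t) - g * t = (A g - g) * A t + g * (A t - t) := by
        rw [map_mul]; ring
      rw [e]
      refine Ideal.add_mem _ ?_ ?_
      · have := Ideal.mul_mem_mul (ih g hg) ((map_mem_aug A m h t).2 ht)
        rw [← pow_succ] at this
        convert this using 2
        omega
      · have := Ideal.mul_mem_mul hg (sub_mem_all A _ h t)
        rw [← pow_add] at this
        convert this using 2
        omega
    | add x _ y _ hx hy =>
      rw [map_add, add_sub_add_comm]
      exact Ideal.add_mem _ hx hy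

end helpers

/-- **Commutators of augmentation subgroups.** Let `I = (x_1,…,x_n)` be the augmentation
ideal of `K[x_1,…,x_n]`, and for `N ≥ 2` let `H_N` consist of the automorphisms `φ` with
`φ(x_i) − x_i ∈ I^N` for all `i`. Then for `m, k ≥ 2`, `ψ₁ ∈ H_m`, `ψ₂ ∈ H_k`, the
commutator `ψ₁⁻¹∘ψ₂⁻¹∘ψ₁∘ψ₂` belongs to `H_{m+k−1}`. -/
theorem commutator_augmentation_subgroups (K : Type*) [Field K] (n : ℕ) (hn : 1 ≤ n)
    (m k : ℕ) (hm : 2 ≤ m) (hk : 2 ≤ k)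
    (ψ₁ ψ₂ : MvPolynomial (Fin n) K ≃ₐ[K] MvPolynomial (Fin n) K)
    (h₁ : ∀ i : Fin n, ψ₁ (X i) - X i ∈
      (Ideal.span (Set.range (X : Fin n → MvPolynomial (Fin n) K))) ^ m)
    (h₂ : ∀ i : Fin n, ψ₂ (X i) - X i ∈
      (Ideal.span (Set.range (X : Fin n → MvPolynomial (Fin n) K))) ^ k) :
    ∀ i : Fin n, (ψ₁⁻¹ * ψ₂⁻¹ * ψ₁ * ψ₂) (X i) - X i ∈
      (Ideal.span (Set.range (X : Fin n → MvPolynomial (Fin n) K))) ^ (m + k - 1) := by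
  intro i
  obtain ⟨m, rfl⟩ : ∃ m', m = m' + 1 := ⟨m - 1, by omega⟩
  obtain ⟨k, rfl⟩ : ∃ k', k = k' + 1 := ⟨k - 1, by omega⟩
  change ∀ i, _ ∈ augI K n ^ _ at h₁ h₂
  change _ ∈ augI K n ^ _
  have a := sub_mem_pow ψ₁ m h₁ _ _ (h₂ i)
  have b := sub_mem_pow ψ₂ k h₂ _ _ (h₁ i)
  rw [show k + 1 + m = m + 1 + (k + 1) - 1 by omega] at a
  rw [show m + 1 + k = m + 1 + (k + 1) - 1 by omega] at b
  have c := symm_mem_pow ψ₁ m h₁ _ _ (symm_mem_pow ψ₂ k h₂ _ _ (Ideal.sub_mem _ a b))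
  have e : ψ₁ (ψ₂ (X i) - X i) - (ψ₂ (X i) - X i) - (ψ₂ (ψ₁ (X i) - X i) - (ψ₁ (X i) - X i))
      = ψ₁ (ψ₂ (X i)) - ψ₂ (ψ₁ (X i)) := by
    rw [map_sub, map_sub]; ring
  have e2 : ψ₁⁻¹ (ψ₂⁻¹ (ψ₂ (ψ₁ (X i)))) = X i := by
    have h3 : ψ₂⁻¹ (ψ₂ (ψ₁ (X i))) = ψ₁ (X i) := ψ₂.symm_apply_apply _
    rw [h3]
    exact ψ₁.symm_apply_apply _
  rw [e, map_sub, map_sub, e2] at c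
  exact c
end

section
/- Let K be a field. In the automorphism group of K[x,y,z], let ψ be the automorphism with ψ(x)=x, ψ(y)=y, ψ(z)=z+xy, and let L be the set of linear automorphisms. Then for every b ∈ K and every m ≥ 1, the automorphism φ_m^b given by x ↦ x, y ↦ y, z ↦ z + b·x^m belongs to the subgroup generated by L ∪ {ψ}. -/
open MvPolynomial

/-- An automorphism of `K[x,y,z]` is linear if the image of each variable is a
`K`-linear combination of the variables. -/
def IsLinearAut3 {K : Type*} [Field K]
    (e : MvPolynomial (Fin 3) K ≃ₐ[K] MvPolynomial (Fin 3) K) : Prop :=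
  ∀ i : Fin 3,
    e (X i) ∈ Submodule.span K (Set.range (X : Fin 3 → MvPolynomial (Fin 3) K))

/-- Two automorphisms agreeing on the three variables are equal. -/
theorem aut3_ext {K : Type*} [Field K]
    {e f : MvPolynomial (Fin 3) K ≃ₐ[K] MvPolynomial (Fin 3) K}
    (h0 : e (X 0) = f (X 0)) (h1 : e (X 1) = f (X 1)) (h2 : e (X 2) = f (X 2)) : e = f := by
  have h : (e : MvPolynomial (Fin 3) K →ₐ[K] MvPolynomial (Fin 3) K) = f := by
    apply MvPolynomial.algHom_ext
    intro i
    fin_cases i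
    · exact h0
    · exact h1
    · exact h2
  ext1 p
  exact DFunLike.congr_fun h p

/-- The automorphism `z ↦ z + b x ^ m` exists. -/
theorem exists_elem3 {K : Type*} [Field K] (b : K) (m : ℕ) :
    ∃ φ : MvPolynomial (Fin 3) K ≃ₐ[K] MvPolynomial (Fin 3) K,
      φ (X 0) = X 0 ∧ φ (X 1) = X 1 ∧ φ (X 2) = X 2 + C b * (X 0) ^ m := by
  let F : K → (MvPolynomial (Fin 3) K →ₐ[K] MvPolynomial (Fin 3) K) := fun c =>
    aeval ![X 0, X 1, X 2 + C c * (X 0) ^ m]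
  have F0 : ∀ c, F c (X 0) = X 0 := fun c => by simp [F]
  have F1 : ∀ c, F c (X 1) = X 1 := fun c => by simp [F]
  have F2 : ∀ c, F c (X 2) = X 2 + C c * (X 0) ^ m := fun c => by simp [F]
  have FC : ∀ c d, F c (C d) = C d := fun c d => (F c).commutes d
  have hF : ∀ c, (F c).comp (F (-c)) = AlgHom.id K _ := by
    intro c
    apply MvPolynomial.algHom_ext
    intro i
    fin_cases i
    · change F c (F (-c) (X 0)) = X 0
      rw [F0, F0]
    · change F c (F (-c) (X 1)) = X 1
      rw [F1, F1]
    · change F c (F (-c) (X 2)) = X 2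
      rw [F2, map_add, map_mul, map_pow, F2, F0, FC, C_neg]
      ring
  refine ⟨AlgEquiv.ofAlgHom (F b) (F (-b)) (hF b) ?_, F0 b, F1 b, F2 b⟩
  have := hF (-b)
  rwa [neg_neg] at this

/-- Let `ψ` be the automorphism of `K[x,y,z]` with `ψ(x)=x, ψ(y)=y, ψ(z)=z+xy`, and
let `L` be the set of linear automorphisms. Then for every `b ∈ K` and `m ≥ 1` the
automorphism `x ↦ x, y ↦ y, z ↦ z + b·x^m` lies in the subgroup generated by
`L ∪ {ψ}`. -/
theorem power_elementary_in_group_generated_by_linear_and_psi (K : Type*) [Field K]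
    (ψ : MvPolynomial (Fin 3) K ≃ₐ[K] MvPolynomial (Fin 3) K)
    (hψ0 : ψ (X 0) = X 0) (hψ1 : ψ (X 1) = X 1)
    (hψ2 : ψ (X 2) = X 2 + X 0 * X 1)
    (b : K) (m : ℕ) (hm : 1 ≤ m)
    (φ : MvPolynomial (Fin 3) K ≃ₐ[K] MvPolynomial (Fin 3) K)
    (hφ0 : φ (X 0) = X 0) (hφ1 : φ (X 1) = X 1)
    (hφ2 : φ (X 2) = X 2 + C b * (X 0) ^ m) :
    φ ∈ Subgroup.closure
      ({e : MvPolynomial (Fin 3) K ≃ₐ[K] MvPolynomial (Fin 3) K | IsLinearAut3 e}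
        ∪ {ψ}) := by
  set G := Subgroup.closure
      ({e : MvPolynomial (Fin 3) K ≃ₐ[K] MvPolynomial (Fin 3) K | IsLinearAut3 e} ∪ {ψ}) with hG
  have hX : ∀ i : Fin 3, (X i : MvPolynomial (Fin 3) K) ∈
      Submodule.span K (Set.range (X : Fin 3 → MvPolynomial (Fin 3) K)) :=
    fun i => Submodule.subset_span ⟨i, rfl⟩
  have hL : ∀ e, IsLinearAut3 e → e ∈ G := fun e he => Subgroup.subset_closure (Or.inl he)
  have hψ : ψ ∈ G := Subgroup.subset_closure (Or.inr rfl)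
  induction m, hm using Nat.le_induction generalizing φ with
  | base =>
    apply hL
    intro i
    fin_cases i
    · change φ (X 0) ∈ _
      rw [hφ0]; exact hX 0
    · change φ (X 1) ∈ _
      rw [hφ1]; exact hX 1
    · change φ (X 2) ∈ _
      rw [hφ2, pow_one, ← smul_eq_C_mul]
      exact Submodule.add_mem _ (hX 2) (Submodule.smul_mem _ _ (hX 0))
  | succ m hm ih =>
    obtain ⟨τ, h0, h1, h2⟩ := exists_elem3 b m
    have hτ : τ ∈ G := ih τ h0 h1 h2
    let s : MvPolynomial (Fin 3) K ≃ₐ[K] MvPolynomial (Fin 3) K :=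
      renameEquiv K (Equiv.swap (1 : Fin 3) 2)
    have sX : ∀ i, s (X i) = X (Equiv.swap (1 : Fin 3) 2 i) := fun i => by simp [s]
    have s0 : s (X 0) = X 0 := sX 0
    have s1 : s (X 1) = X 2 := sX 1
    have s2 : s (X 2) = X 1 := sX 2
    have hs : s ∈ G := hL s fun i => by rw [sX]; exact hX _
    have hC : ∀ (e : MvPolynomial (Fin 3) K ≃ₐ[K] MvPolynomial (Fin 3) K) (c : K),
      e (C c) = C c := fun e c => e.commutes c
    obtain ⟨σ, hσ⟩ : ∃ σ, σ = s * τ * s := ⟨_, rfl⟩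
    have hσG : σ ∈ G := hσ ▸ G.mul_mem (G.mul_mem hs hτ) hs
    have σ0 : σ (X 0) = X 0 := by simp only [hσ, AlgEquiv.mul_apply, s0, h0]
    have σ1 : σ (X 1) = X 1 + C b * X 0 ^ m := by
      simp only [hσ, AlgEquiv.mul_apply, s1, h2, map_add, map_mul, map_pow, hC, s2, s0]
    have σ2 : σ (X 2) = X 2 := by simp only [hσ, AlgEquiv.mul_apply, s2, h1, s1]
    have key : φ * ψ * σ = σ * ψ := by
      apply aut3_ext
      · simp only [AlgEquiv.mul_apply, σ0, hψ0, hφ0]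
      · simp only [AlgEquiv.mul_apply, σ1, hψ1, hφ1, map_add, map_mul, map_pow, hC, hψ0, hφ0]
      · simp only [AlgEquiv.mul_apply, σ0, σ1, σ2, hψ2, hφ0, hφ1, hφ2, map_add, map_mul]
        ring
    have : φ = σ * ψ * (ψ * σ)⁻¹ := by
      rw [← key]; group
    rw [this]
    exact G.mul_mem (G.mul_mem hσG hψ) (G.inv_mem (G.mul_mem hψ hσG))
end

section
/- Non-lifting of the polynomial automorphism group: let K be a field and n > 2. Let ab : K⟨x_1,…,x_n⟩ → K[x_1,…,x_n] be the canonical abelianization K-algebra homomorphism sending each free generator x_i to the commutative variable x_i, and let Aut_0(K[x_1,…,x_n]) be the group of K-algebra automorphisms φ such that every φ(x_i) has zero constant term. Then there is no group homomorphism Ψ : Aut_0(K[x_1,…,x_n]) → Aut_K(K⟨x_1,…,x_n⟩) satisfying ab ∘ Ψ(φ) = φ ∘ ab for all φ; in other words, Aut_0(K[x_1,…,x_n]) is not isomorphic to a subgroup of Aut(K⟨x_1,…,x_n⟩) via the natural abelianization. -/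
open MvPolynomial

/-- An automorphism of `K[x_1,…,x_n]` is origin-preserving if the image of each
variable has zero constant term. -/
def OriginPres {K : Type*} [Field K] {n : ℕ}
    (φ : MvPolynomial (Fin n) K ≃ₐ[K] MvPolynomial (Fin n) K) : Prop :=
  ∀ i : Fin n, constantCoeff (φ (X i)) = 0


namespace NoLift

section alg
variable {K : Type*} [Field K] {n : ℕ}

/-- augmentation -/
noncomputable def eps (K : Type*) [Field K] (n : ℕ) : FreeAlgebra K (Fin n) →ₐ[K] K :=
  FreeAlgebra.lift K (fun _ => 0)

/-- augmentation ideal, as a `K`-subspace -/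
noncomputable def aug (K : Type*) [Field K] (n : ℕ) : Submodule K (FreeAlgebra K (Fin n)) :=
  LinearMap.ker (eps K n).toLinearMap

/-- abelianization -/
noncomputable def ab (K : Type*) [Field K] (n : ℕ) :
    FreeAlgebra K (Fin n) →ₐ[K] MvPolynomial (Fin n) K :=
  FreeAlgebra.lift K (fun i : Fin n => (MvPolynomial.X i : MvPolynomial (Fin n) K))

/-- free generators -/
noncomputable def gx (K : Type*) [Field K] {n : ℕ} (i : Fin n) : FreeAlgebra K (Fin n) :=
  FreeAlgebra.ι K i

@[simp] lemma ab_gx (i : Fin n) : ab K n (gx K i) = X i := by simp [ab, gx]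
@[simp] lemma eps_gx (i : Fin n) : eps K n (gx K i) = 0 := by simp [eps, gx]

lemma mem_aug {a : FreeAlgebra K (Fin n)} : a ∈ aug K n ↔ eps K n a = 0 := by
  simp [aug]

lemma gx_mem (i : Fin n) : gx K i ∈ aug K n := by simp [mem_aug]

lemma eps_eq (a : FreeAlgebra K (Fin n)) : eps K n a = constantCoeff (ab K n a) := by
  have : eps K n = (aeval (fun _ => (0:K))).comp (ab K n) := by
    apply FreeAlgebra.hom_ext
    funext i
    simp [eps, ab]
  rw [this]
  simp [constantCoeff_eq]

lemma aug_mul_left {k : ℕ} (a : FreeAlgebra K (Fin n)) {b : FreeAlgebra K (Fin n)}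
    (hb : b ∈ aug K n ^ (k+1)) : a * b ∈ aug K n ^ (k+1) := by
  rw [pow_succ'] at hb ⊢
  induction hb using Submodule.mul_induction_on' with
  | mem_mul_mem x hx y hy =>
    rw [← mul_assoc]
    apply Submodule.mul_mem_mul _ hy
    rw [mem_aug] at *
    simp [hx]
  | add x _ y _ h1 h2 => rw [mul_add]; exact add_mem h1 h2

lemma aug_mul_right {k : ℕ} (a : FreeAlgebra K (Fin n)) {b : FreeAlgebra K (Fin n)}
    (hb : b ∈ aug K n ^ (k+1)) : b * a ∈ aug K n ^ (k+1) := by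
  rw [pow_succ] at hb ⊢
  induction hb using Submodule.mul_induction_on' with
  | mem_mul_mem x hx y hy =>
    rw [mul_assoc]
    apply Submodule.mul_mem_mul hx
    rw [mem_aug] at *
    simp [hy]
  | add x _ y _ h1 h2 => rw [add_mul]; exact add_mem h1 h2

lemma aug_mul {k l : ℕ} {a b : FreeAlgebra K (Fin n)}
    (ha : a ∈ aug K n ^ k) (hb : b ∈ aug K n ^ l) : a * b ∈ aug K n ^ (k+l) := by
  rw [pow_add]; exact Submodule.mul_mem_mul ha hb

lemma aug_le (k l : ℕ) (h : k + 1 ≤ l) : aug K n ^ l ≤ aug K n ^ (k+1) := by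
  intro a ha
  obtain ⟨m, rfl⟩ := Nat.exists_eq_add_of_le h
  rw [add_comm, pow_add] at ha
  induction ha using Submodule.mul_induction_on' with
  | mem_mul_mem x hx y hy => exact aug_mul_left x hy
  | add x _ y _ h1 h2 => exact add_mem h1 h2

lemma aug_one {a : FreeAlgebra K (Fin n)} : a ∈ aug K n ^ 1 ↔ eps K n a = 0 := by
  rw [pow_one, mem_aug]

lemma ind {C : FreeAlgebra K (Fin n) → Prop}
    (h0 : ∀ r : K, C (algebraMap K _ r)) (h1 : ∀ i, C (gx K i))
    (h2 : ∀ a b, C a → C b → C (a * b)) (h3 : ∀ a b, C a → C b → C (a + b)) (a) : C a :=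
  FreeAlgebra.induction (R := K) (X := Fin n) (motive := C) h0 h1 h2 h3 a

lemma map_aug (F : FreeAlgebra K (Fin n) →ₐ[K] FreeAlgebra K (Fin n))
    (hF : ∀ a, eps K n (F a) = eps K n a) {k : ℕ} {a : FreeAlgebra K (Fin n)}
    (ha : a ∈ aug K n ^ k) : F a ∈ aug K n ^ k := by
  have h1 : (aug K n).map F.toLinearMap ≤ aug K n := by
    rintro _ ⟨b, hb, rfl⟩
    have hb' : b ∈ aug K n := hb
    rw [mem_aug] at *
    simpa [hF] using hb'
  have h2 : (aug K n ^ k).map F.toLinearMap ≤ aug K n ^ k := by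
    rw [Submodule.map_pow]
    exact pow_le_pow_left' h1 k
  exact h2 ⟨a, ha, rfl⟩

lemma unip_all {r : ℕ} (F : FreeAlgebra K (Fin n) →ₐ[K] FreeAlgebra K (Fin n))
    (h : ∀ i, F (gx K i) - gx K i ∈ aug K n ^ (r+1)) (a) : F a - a ∈ aug K n ^ (r+1) := by
  induction a using ind with
  | h0 r => simp
  | h1 i => exact h i
  | h2 a b ha hb =>
    have : F (a*b) - a*b = F a * (F b - b) + (F a - a) * b := by
      rw [map_mul]; noncomm_ring
    rw [this]
    exact add_mem (aug_mul_left _ hb) (aug_mul_right _ ha)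
  | h3 a b ha hb =>
    have : F (a+b) - (a+b) = (F a - a) + (F b - b) := by
      rw [map_add]; abel
    rw [this]; exact add_mem ha hb

lemma unip {r : ℕ} (F : FreeAlgebra K (Fin n) →ₐ[K] FreeAlgebra K (Fin n))
    (hF : ∀ a, eps K n (F a) = eps K n a)
    (h : ∀ i, F (gx K i) - gx K i ∈ aug K n ^ (r+1)) (k : ℕ) (a)
    (ha : a ∈ aug K n ^ (k+1)) : F a - a ∈ aug K n ^ (k + 1 + r) := by
  induction k generalizing a with
  | zero => rw [zero_add, add_comm]; exact unip_all F h a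
  | succ k ih =>
    rw [pow_succ] at ha
    induction ha using Submodule.mul_induction_on' with
    | mem_mul_mem x hx y hy =>
      have : F (x*y) - x*y = F x * (F y - y) + (F x - x) * y := by
        rw [map_mul]; noncomm_ring
      rw [this]
      apply add_mem
      · have := aug_mul (map_aug F hF hx) (unip_all F h y)
        convert this using 2; ring
      · have := aug_mul (ih x hx) (show y ∈ aug K n ^ 1 by simpa using hy)
        convert this using 2; ring
    | add x _ y _ h1 h2 =>
      have : F (x+y) - (x+y) = (F x - x) + (F y - y) := by
        rw [map_add]; abel
      rw [this]; exact add_mem h1 h2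

/-! ### test functionals -/

/-- test homomorphism to strictly triangular matrices -/
noncomputable def tst (m : ℕ) (w : Fin m → Fin n → K) :
    FreeAlgebra K (Fin n) →ₐ[K] Matrix (Fin m) (Fin m) K :=
  FreeAlgebra.lift K (fun i => Matrix.of fun r s => if (r:ℕ) + 1 = s then w r i else 0)

lemma tst_gx (m : ℕ) (w : Fin m → Fin n → K) (i : Fin n) (r s : Fin m) :
    tst m w (gx K i) r s = if (r:ℕ) + 1 = s then w r i else 0 := by
  simp [tst, gx]

lemma tst_tri (m : ℕ) (w : Fin m → Fin n → K) (a : FreeAlgebra K (Fin n)) (r s : Fin m)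
    (h : s ≤ r) : tst m w a r s = if r = s then eps K n a else 0 := by
  induction a using ind generalizing r s with
  | h0 c => simp [Matrix.algebraMap_matrix_apply]
  | h1 i =>
    rw [tst_gx, if_neg (by rw [Fin.le_def] at h; omega)]; simp
  | h2 a b ha hb =>
    rw [map_mul, Matrix.mul_apply, Finset.sum_eq_single r]
    · rw [ha r r le_rfl, hb r s h]; simp
    · intro t _ ht
      rcases lt_or_gt_of_ne ht with h1 | h1
      · rw [ha r t h1.le, if_neg ht.symm, zero_mul]
      · rw [hb t s (h.trans h1.le), if_neg (ne_of_gt (lt_of_le_of_lt h h1)), mul_zero]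
    · simp
  | h3 a b ha hb =>
    rw [map_add, Matrix.add_apply, ha r s h, hb r s h]; split_ifs <;> simp

lemma tst_kill (m : ℕ) (w : Fin m → Fin n → K) (k : ℕ) (a : FreeAlgebra K (Fin n))
    (ha : a ∈ aug K n ^ (k+1)) (r s : Fin m) (h : (s:ℕ) < r + (k+1)) : tst m w a r s = 0 := by
  induction k generalizing a r s with
  | zero =>
    rw [zero_add, aug_one] at ha
    rw [tst_tri m w a r s (by rw [Fin.le_def]; omega), ha]; simp
  | succ k ih =>
    rw [pow_succ] at ha
    induction ha using Submodule.mul_induction_on' with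
    | mem_mul_mem x hx y hy =>
      rw [map_mul, Matrix.mul_apply]
      apply Finset.sum_eq_zero
      intro t _
      by_cases ht : (t:ℕ) < r + (k+1)
      · rw [ih x hx r t ht, zero_mul]
      · rw [mem_aug] at hy
        rw [tst_tri m w y t s (by rw [Fin.le_def]; omega), hy]; simp
    | add x _ y _ h1 h2 => rw [map_add, Matrix.add_apply, h1, h2, add_zero]

/-- linear coefficient functional -/
noncomputable def lam (u : Fin n → K) (a : FreeAlgebra K (Fin n)) : K :=
  tst 2 (fun _ => u) a 0 1

lemma lam_mul (u : Fin n → K) (a b : FreeAlgebra K (Fin n)) :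
    lam u (a * b) = eps K n a * lam u b + lam u a * eps K n b := by
  unfold lam
  rw [map_mul, Matrix.mul_apply, Fin.sum_univ_two, tst_tri _ _ a 0 0 le_rfl,
    tst_tri _ _ b 1 1 le_rfl]
  simp

lemma lam_add (u : Fin n → K) (a b : FreeAlgebra K (Fin n)) :
    lam u (a + b) = lam u a + lam u b := by
  simp [lam]
lemma lam_sub (u : Fin n → K) (a b : FreeAlgebra K (Fin n)) :
    lam u (a - b) = lam u a - lam u b := by
  simp [lam]
lemma lam_smul (u : Fin n → K) (c : K) (a : FreeAlgebra K (Fin n)) :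
    lam u (c • a) = c * lam u a := by
  simp [lam]
@[simp] lemma lam_gx (u : Fin n → K) (i : Fin n) : lam u (gx K i) = u i := by
  simp [lam, tst_gx]
@[simp] lemma lam_alg (u : Fin n → K) (c : K) : lam u (algebraMap K _ c) = 0 := by
  simp [lam, Matrix.algebraMap_matrix_apply]

lemma lam_kill (u : Fin n → K) {a : FreeAlgebra K (Fin n)} (ha : a ∈ aug K n ^ 2) :
    lam u a = 0 := tst_kill 2 _ 1 a ha 0 1 (by simp)

lemma tst_lam (m : ℕ) (w : Fin m → Fin n → K) (a : FreeAlgebra K (Fin n)) (r s : Fin m)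
    (h : (r:ℕ) + 1 = s) : tst m w a r s = lam (w r) a := by
  have hrs : r ≠ s := by rintro rfl; omega
  induction a using ind with
  | h0 c => rw [lam_alg]; simp [Matrix.algebraMap_matrix_apply, hrs]
  | h1 i => rw [tst_gx, if_pos h, lam_gx]
  | h2 a b ha hb =>
    rw [map_mul, Matrix.mul_apply, lam_mul, ← Finset.sum_subset (Finset.subset_univ {r, s}),
      Finset.sum_pair hrs, tst_tri _ _ a r r le_rfl, tst_tri _ _ b s s le_rfl, ha, hb]
    · simp
    · intro t _ ht
      simp only [Finset.mem_insert, Finset.mem_singleton, not_or] at ht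
      by_cases h1 : t ≤ r
      · rw [tst_tri _ _ a r t h1, if_neg (Ne.symm ht.1), zero_mul]
      · rw [tst_tri _ _ b t s (by rw [Fin.le_def] at *; omega), if_neg ht.2, mul_zero]
  | h3 a b ha hb => rw [map_add, Matrix.add_apply, lam_add, ha, hb]

lemma lam_add_left (u v : Fin n → K) (a : FreeAlgebra K (Fin n)) :
    lam (u + v) a = lam u a + lam v a := by
  induction a using ind with
  | h0 c => simp
  | h1 i => simp
  | h2 a b ha hb => simp only [lam_mul, ha, hb]; ring
  | h3 a b ha hb => simp only [lam_add, ha, hb]; ring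

lemma lam_smul_left (c : K) (u : Fin n → K) (a : FreeAlgebra K (Fin n)) :
    lam (c • u) a = c * lam u a := by
  induction a using ind with
  | h0 c => simp
  | h1 i => simp
  | h2 a b ha hb => simp only [lam_mul, ha, hb]; ring
  | h3 a b ha hb => simp only [lam_add, ha, hb]; ring

lemma lam_comp (u u' : Fin n → K) (F : FreeAlgebra K (Fin n) →ₐ[K] FreeAlgebra K (Fin n))
    (hF : ∀ a, eps K n (F a) = eps K n a) (h : ∀ i, lam u (F (gx K i)) = u' i) (a) :
    lam u (F a) = lam u' a := by
  induction a using ind with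
  | h0 c => simp
  | h1 i => simp [h]
  | h2 a b ha hb => simp only [map_mul, lam_mul, ha, hb, hF]
  | h3 a b ha hb => simp only [map_add, lam_add, ha, hb]

/-- quadratic coefficient functional -/
noncomputable def bet (u v : Fin n → K) (a : FreeAlgebra K (Fin n)) : K :=
  tst 3 ![u, v, 0] a 0 2

lemma bet_mul (u v : Fin n → K) {a b : FreeAlgebra K (Fin n)} (ha : a ∈ aug K n)
    (hb : b ∈ aug K n) : bet u v (a * b) = lam u a * lam v b := by
  unfold bet
  rw [mem_aug] at ha hb
  rw [map_mul, Matrix.mul_apply, Fin.sum_univ_three, tst_tri _ _ a 0 0 le_rfl,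
    tst_tri _ _ b 2 2 le_rfl, tst_lam _ _ a 0 1 (by simp), tst_lam _ _ b 1 2 (by simp), ha, hb]
  simp

lemma bet_add (u v : Fin n → K) (a b : FreeAlgebra K (Fin n)) :
    bet u v (a + b) = bet u v a + bet u v b := by
  simp [bet]
lemma bet_sub (u v : Fin n → K) (a b : FreeAlgebra K (Fin n)) :
    bet u v (a - b) = bet u v a - bet u v b := by
  simp [bet]
lemma bet_smul (u v : Fin n → K) (c : K) (a : FreeAlgebra K (Fin n)) :
    bet u v (c • a) = c * bet u v a := by
  simp [bet]
@[simp] lemma bet_zero (u v : Fin n → K) : bet u v (0 : FreeAlgebra K (Fin n)) = 0 := by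
  simp [bet]
lemma bet_sum (u v : Fin n → K) {ι : Type*} (s : Finset ι) (f : ι → FreeAlgebra K (Fin n)) :
    bet u v (∑ i ∈ s, f i) = ∑ i ∈ s, bet u v (f i) := by
  simp [bet, Matrix.sum_apply]
lemma lam_sum (u : Fin n → K) {ι : Type*} (s : Finset ι) (f : ι → FreeAlgebra K (Fin n)) :
    lam u (∑ i ∈ s, f i) = ∑ i ∈ s, lam u (f i) := by
  simp [lam, Matrix.sum_apply]

lemma bet_kill (u v : Fin n → K) {a : FreeAlgebra K (Fin n)} (ha : a ∈ aug K n ^ 3) :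
    bet u v a = 0 := tst_kill 3 _ 2 a ha 0 2 (by simp)

lemma bet_congr (u v : Fin n → K) {a b : FreeAlgebra K (Fin n)} (h : a - b ∈ aug K n ^ 3) :
    bet u v a = bet u v b := by
  have := bet_kill u v h
  rw [bet_sub] at this
  exact sub_eq_zero.1 this

@[elab_as_elim]
lemma sq_ind {C : FreeAlgebra K (Fin n) → Prop} {q : FreeAlgebra K (Fin n)}
    (hq : q ∈ aug K n ^ 2) (h1 : ∀ a ∈ aug K n, ∀ b ∈ aug K n, C (a * b))
    (h2 : ∀ a b, C a → C b → C (a + b)) : C q := by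
  rw [sq] at hq
  exact Submodule.mul_induction_on hq h1 h2

lemma bet_add_left (u u' v : Fin n → K) {q : FreeAlgebra K (Fin n)} (hq : q ∈ aug K n ^ 2) :
    bet (u + u') v q = bet u v q + bet u' v q := by
  refine sq_ind hq (fun a ha b hb => ?_) (fun a b ha hb => ?_)
  · simp only [bet_mul _ _ ha hb, lam_add_left]; ring
  · simp only [bet_add, ha, hb]; ring

lemma bet_add_right (u v v' : Fin n → K) {q : FreeAlgebra K (Fin n)} (hq : q ∈ aug K n ^ 2) :
    bet u (v + v') q = bet u v q + bet u v' q := by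
  refine sq_ind hq (fun a ha b hb => ?_) (fun a b ha hb => ?_)
  · simp only [bet_mul _ _ ha hb, lam_add_left]; ring
  · simp only [bet_add, ha, hb]; ring

lemma bet_smul_smul (c d : K) (u v : Fin n → K) {q : FreeAlgebra K (Fin n)}
    (hq : q ∈ aug K n ^ 2) : bet (c • u) (d • v) q = c * d * bet u v q := by
  refine sq_ind hq (fun a ha b hb => ?_) (fun a b ha hb => ?_)
  · simp only [bet_mul _ _ ha hb, lam_smul_left]; ring
  · simp only [bet_add, ha, hb]; ring

lemma bet_comp (u u' v v' : Fin n → K) (F : FreeAlgebra K (Fin n) →ₐ[K] FreeAlgebra K (Fin n))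
    (hF : ∀ a, eps K n (F a) = eps K n a) (h : ∀ i, lam u (F (gx K i)) = u' i)
    (h' : ∀ i, lam v (F (gx K i)) = v' i) {q : FreeAlgebra K (Fin n)}
    (hq : q ∈ aug K n ^ 2) : bet u v (F q) = bet u' v' q := by
  refine sq_ind hq (fun a ha b hb => ?_) (fun a b ha hb => ?_)
  · rw [map_mul, bet_mul _ _ ha hb, bet_mul, lam_comp u u' F hF h, lam_comp v v' F hF h']
    · rw [mem_aug] at *; rw [hF, ha]
    · rw [mem_aug] at *; rw [hF, hb]
  · simp only [map_add, bet_add, ha, hb]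

lemma tst_const_ab (m : ℕ) (u : Fin n → K) (a : FreeAlgebra K (Fin n)) (ha : ab K n a = 0) :
    tst m (fun _ => u) a = 0 := by
  let N : Matrix (Fin m) (Fin m) K := Matrix.of fun r s => if (r:ℕ) + 1 = s then 1 else 0
  have : tst m (fun _ => u) = ((Polynomial.aeval N).comp
      (aeval (fun i => Polynomial.C (u i) * Polynomial.X))).comp (ab K n) := by
    apply FreeAlgebra.hom_ext
    funext i
    ext r s
    simp [tst, ab, N, Algebra.algebraMap_eq_smul_one]
  rw [this]; simp [ha]

lemma bet_eq (u v : Fin n → K) (w : Fin 3 → Fin n → K) (h0 : w 0 = u) (h1 : w 1 = v)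
    {q : FreeAlgebra K (Fin n)} (hq : q ∈ aug K n ^ 2) : tst 3 w q 0 2 = bet u v q := by
  refine sq_ind hq (fun a ha b hb => ?_) (fun a b ha hb => ?_)
  · rw [bet_mul _ _ ha hb]
    rw [mem_aug] at ha hb
    rw [map_mul, Matrix.mul_apply, Fin.sum_univ_three, tst_tri _ _ a 0 0 le_rfl,
      tst_tri _ _ b 2 2 le_rfl, tst_lam _ _ a 0 1 (by simp), tst_lam _ _ b 1 2 (by simp), ha, hb,
      h0, h1]
    simp
  · rw [map_add, bet_add, Matrix.add_apply, ha, hb]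

/-- every element is a constant plus a combination of generators -/
lemma decomp (a : FreeAlgebra K (Fin n)) : ∃ f : Fin n → FreeAlgebra K (Fin n),
    a = algebraMap K _ (eps K n a) + ∑ i, f i * gx K i := by
  induction a using ind with
  | h0 c => exact ⟨0, by simp⟩
  | h1 i =>
    refine ⟨Pi.single i 1, ?_⟩
    rw [Finset.sum_eq_single i]
    · simp
    · intro j _ hj; simp [hj]
    · simp
  | h2 a b ha hb =>
    obtain ⟨f, hf⟩ := ha
    obtain ⟨g, hg⟩ := hb
    refine ⟨fun i => eps K n b • f i + a * g i, ?_⟩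
    have h1 : a * b = eps K n b • a + ∑ i, a * g i * gx K i := by
      conv_lhs => rw [hg]
      rw [mul_add, ← Algebra.commutes, ← Algebra.smul_def, Finset.mul_sum]
      simp [mul_assoc]
    have h2 : eps K n b • a = algebraMap K _ (eps K n a * eps K n b) +
        ∑ i, eps K n b • f i * gx K i := by
      conv_lhs => rw [hf]
      rw [smul_add, Finset.smul_sum, mul_comm, map_mul, Algebra.smul_def]
      simp
    rw [map_mul (eps K n), h1, h2]
    simp only [add_mul, Finset.sum_add_distrib, add_assoc]
  | h3 a b ha hb =>
    obtain ⟨f, hf⟩ := ha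
    obtain ⟨g, hg⟩ := hb
    refine ⟨f + g, ?_⟩
    conv_lhs => rw [hf, hg]
    simp only [Pi.add_apply, add_mul, Finset.sum_add_distrib, map_add]
    abel

lemma mem_sq {a : FreeAlgebra K (Fin n)} (h0 : eps K n a = 0)
    (h : ∀ j, lam (Pi.single j 1) a = 0) : a ∈ aug K n ^ 2 := by
  obtain ⟨f, hf⟩ := decomp a
  rw [h0, map_zero, zero_add] at hf
  rw [hf, sq]
  refine Submodule.sum_mem _ fun i _ => Submodule.mul_mem_mul ?_ (gx_mem i)
  have := h i
  rw [hf, lam_sum, Finset.sum_eq_single i] at this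
  · rw [mem_aug]; simpa [lam_mul] using this
  · intro j _ hj; simp [lam_mul, hj]
  · simp

lemma mem_cube {a : FreeAlgebra K (Fin n)} (h0 : a ∈ aug K n ^ 2)
    (h : ∀ p q, bet (Pi.single p 1) (Pi.single q 1) a = 0) : a ∈ aug K n ^ 3 := by
  obtain ⟨f, hf⟩ := decomp a
  have e0 : eps K n a = 0 := aug_one.1 (aug_le 0 2 (by norm_num) h0)
  rw [e0, map_zero, zero_add] at hf
  have hfe : ∀ i, f i ∈ aug K n := by
    intro i
    have := lam_kill (Pi.single i 1) h0
    rw [hf, lam_sum, Finset.sum_eq_single i] at this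
    · rw [mem_aug]; simpa [lam_mul] using this
    · intro j _ hj; simp [lam_mul, hj]
    · simp
  rw [hf, pow_succ]
  refine Submodule.sum_mem _ fun i _ => Submodule.mul_mem_mul ?_ (gx_mem i)
  refine mem_sq (mem_aug.1 (hfe i)) fun p => ?_
  have := h p i
  rw [hf, bet_sum, Finset.sum_eq_single i] at this
  · simpa [bet_mul _ _ (hfe i) (gx_mem i)] using this
  · intro j _ hj; simp [bet_mul _ _ (hfe j) (gx_mem j), hj]
  · simp

lemma ker_ab {a : FreeAlgebra K (Fin n)} (h : ab K n a = 0) : a ∈ aug K n ^ 2 := by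
  refine mem_sq (by rw [eps_eq, h, map_zero]) fun j => ?_
  unfold lam
  rw [tst_const_ab _ _ _ h]; rfl

lemma ab_congr {a b : FreeAlgebra K (Fin n)} (h : ab K n a = ab K n b) :
    a - b ∈ aug K n ^ 2 := ker_ab (by rw [map_sub, h, sub_self])

lemma bet_diag (u : Fin n → K) {a : FreeAlgebra K (Fin n)} (h : ab K n a = 0) :
    bet u u a = 0 := by
  rw [← bet_eq u u (fun _ => u) rfl rfl (ker_ab h), tst_const_ab _ _ _ h]; rfl

/-- cubic coefficient functional -/
noncomputable def kap (u v w : Fin n → K) (a : FreeAlgebra K (Fin n)) : K :=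
  tst 4 ![u, v, w, 0] a 0 3

lemma kap_add (u v w : Fin n → K) (a b : FreeAlgebra K (Fin n)) :
    kap u v w (a + b) = kap u v w a + kap u v w b := by
  simp [kap]
lemma kap_sub (u v w : Fin n → K) (a b : FreeAlgebra K (Fin n)) :
    kap u v w (a - b) = kap u v w a - kap u v w b := by
  simp [kap]
lemma kap_smul (u v w : Fin n → K) (c : K) (a : FreeAlgebra K (Fin n)) :
    kap u v w (c • a) = c * kap u v w a := by
  simp [kap]
lemma kap_kill (u v w : Fin n → K) {a : FreeAlgebra K (Fin n)} (ha : a ∈ aug K n ^ 4) :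
    kap u v w a = 0 := tst_kill 4 _ 3 a ha 0 3 (by simp)
lemma kap_congr (u v w : Fin n → K) {a b : FreeAlgebra K (Fin n)} (h : a - b ∈ aug K n ^ 4) :
    kap u v w a = kap u v w b := by
  have := kap_kill u v w h
  rw [kap_sub] at this
  exact sub_eq_zero.1 this

lemma kap_mul (u v w : Fin n → K) {a b c : FreeAlgebra K (Fin n)} (ha : a ∈ aug K n)
    (hb : b ∈ aug K n) (hc : c ∈ aug K n) :
    kap u v w (a * b * c) = lam u a * lam v b * lam w c := by
  unfold kap
  rw [mem_aug] at ha hb hc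
  rw [map_mul, map_mul]
  simp only [Matrix.mul_apply, Fin.sum_univ_four]
  rw [tst_tri _ _ a 0 0 le_rfl, tst_tri _ _ b 1 1 le_rfl, tst_tri _ _ b 2 2 le_rfl,
    tst_tri _ _ c 3 3 le_rfl,
    tst_lam _ _ a 0 1 (by simp), tst_lam _ _ b 1 2 (by simp), tst_lam _ _ c 2 3 (by simp),
    tst_tri _ _ b 1 0 (by decide), tst_tri _ _ b 2 1 (by decide), tst_tri _ _ b 2 0 (by decide),
    tst_tri _ _ b 3 0 (by decide), tst_tri _ _ b 3 1 (by decide), tst_tri _ _ b 3 2 (by decide),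
    ha, hb, hc]
  simp

end alg

end NoLift

namespace NoLift

section lifts
variable {K : Type*} [Field K] {n : ℕ}

/-- `f` does not involve the variable `i` -/
def Indep (i : Fin n) (f : MvPolynomial (Fin n) K) : Prop :=
  ∀ g, aeval (Function.update X i g) f = f

/-- the substitution `x_i ↦ x_i + f` -/
noncomputable def shHom (i : Fin n) (f : MvPolynomial (Fin n) K) :
    MvPolynomial (Fin n) K →ₐ[K] MvPolynomial (Fin n) K :=
  aeval (Function.update X i (X i + f))

lemma shHom_comp (i : Fin n) (f g : MvPolynomial (Fin n) K) (hg : Indep i g) (h : f + g = 0) :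
    (shHom i f).comp (shHom i g) = AlgHom.id K _ := by
  apply MvPolynomial.algHom_ext
  intro k
  by_cases hk : k = i
  · subst hk
    have := hg (X k + f)
    simp only [shHom, AlgHom.comp_apply, aeval_X, Function.update_self, map_add, this,
      AlgHom.id_apply]
    rw [add_assoc, h, add_zero]
  · simp [shHom, hk]

/-- the elementary automorphism `x_i ↦ x_i + f` -/
noncomputable def sh (i : Fin n) (f : MvPolynomial (Fin n) K) (hf : Indep i f) :
    MvPolynomial (Fin n) K ≃ₐ[K] MvPolynomial (Fin n) K :=
  AlgEquiv.ofAlgHom (shHom i f) (shHom i (-f))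
    (shHom_comp i f (-f) (fun g => by rw [map_neg, hf g]) (by ring))
    (shHom_comp i (-f) f hf (by ring))

lemma sh_self (i : Fin n) (f : MvPolynomial (Fin n) K) (hf : Indep i f) :
    sh i f hf (X i) = X i + f := by simp [sh, shHom]

lemma sh_ne (i : Fin n) (f : MvPolynomial (Fin n) K) (hf : Indep i f) (k : Fin n) (h : k ≠ i) :
    sh i f hf (X k) = X k := by simp [sh, shHom, h]

lemma sh_op (i : Fin n) (f : MvPolynomial (Fin n) K) (hf : Indep i f)
    (h0 : constantCoeff f = 0) : OriginPres (sh i f hf) := by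
  intro k
  by_cases hk : k = i
  · subst hk; simp [sh_self, h0]
  · simp [sh_ne _ _ _ _ hk]

/-- sign change of one variable -/
noncomputable def sgHom (w : Fin n) : MvPolynomial (Fin n) K →ₐ[K] MvPolynomial (Fin n) K :=
  aeval (Function.update X w (-X w))

lemma sgHom_comp (w : Fin n) :
    (sgHom w).comp (sgHom w) = AlgHom.id K (MvPolynomial (Fin n) K) := by
  apply MvPolynomial.algHom_ext
  intro k
  by_cases hk : k = w
  · subst hk; simp [sgHom]
  · simp [sgHom, hk]

/-- sign change of one variable, as an automorphism -/
noncomputable def sg (w : Fin n) : MvPolynomial (Fin n) K ≃ₐ[K] MvPolynomial (Fin n) K :=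
  AlgEquiv.ofAlgHom (sgHom w) (sgHom w) (sgHom_comp w) (sgHom_comp w)

lemma sg_self (w : Fin n) : sg w (X w : MvPolynomial (Fin n) K) = -X w := by simp [sg, sgHom]
lemma sg_ne (w k : Fin n) (h : k ≠ w) : sg w (X k : MvPolynomial (Fin n) K) = X k := by
  simp [sg, sgHom, h]
lemma sg_op (w : Fin n) : OriginPres (sg w : MvPolynomial (Fin n) K ≃ₐ[K] _) := by
  intro k
  by_cases hk : k = w
  · subst hk; simp [sg_self]
  · simp [sg_ne _ _ hk]

lemma aut_ext {φ ψ : MvPolynomial (Fin n) K ≃ₐ[K] MvPolynomial (Fin n) K}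
    (h : ∀ k, φ (X k) = ψ (X k)) : φ = ψ := by
  have : (φ : MvPolynomial (Fin n) K →ₐ[K] MvPolynomial (Fin n) K) = ψ :=
    MvPolynomial.algHom_ext h
  ext1 a
  exact DFunLike.congr_fun this a

/-- `F` is an automorphism of the free algebra lifting the origin-preserving `φ` -/
structure IsL (F : FreeAlgebra K (Fin n) ≃ₐ[K] FreeAlgebra K (Fin n))
    (φ : MvPolynomial (Fin n) K ≃ₐ[K] MvPolynomial (Fin n) K) : Prop where
  op : OriginPres φ
  ab : ∀ a, ab K n (F a) = φ (ab K n a)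

variable {F F' G : FreeAlgebra K (Fin n) ≃ₐ[K] FreeAlgebra K (Fin n)}
  {φ φ' ψ : MvPolynomial (Fin n) K ≃ₐ[K] MvPolynomial (Fin n) K}

lemma IsL.eps (h : IsL F φ) (a) : eps K n (F a) = eps K n a := by
  have : (NoLift.eps K n).comp (F : FreeAlgebra K (Fin n) →ₐ[K] FreeAlgebra K (Fin n))
      = NoLift.eps K n := by
    apply FreeAlgebra.hom_ext
    funext i
    have h1 : NoLift.eps K n (F (gx K i)) = 0 := by
      rw [eps_eq, h.ab, ab_gx, h.op i]
    have h2 : NoLift.eps K n (gx K i) = 0 := eps_gx i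
    simpa [gx] using h1.trans h2.symm
  exact DFunLike.congr_fun this a

lemma IsL.mem (h : IsL F φ) {k : ℕ} {a : FreeAlgebra K (Fin n)} (ha : a ∈ aug K n ^ k) :
    F a ∈ aug K n ^ k :=
  map_aug (F : FreeAlgebra K (Fin n) →ₐ[K] FreeAlgebra K (Fin n)) h.eps ha

lemma IsL.of_mem (h : IsL F φ) {k : ℕ} {a : FreeAlgebra K (Fin n)} (ha : F a ∈ aug K n ^ k) :
    a ∈ aug K n ^ k := by
  have := map_aug (F.symm : FreeAlgebra K (Fin n) →ₐ[K] FreeAlgebra K (Fin n))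
    (fun a => by rw [← h.eps]; simp) ha
  simpa using this

lemma IsL.gx_mem (h : IsL F φ) (i : Fin n) : F (gx K i) ∈ aug K n := by
  rw [mem_aug, h.eps, eps_gx]

lemma IsL.unip (h : IsL F φ) {r : ℕ} (hu : ∀ i, F (gx K i) - gx K i ∈ aug K n ^ (r+1))
    (k : ℕ) {a : FreeAlgebra K (Fin n)} (ha : a ∈ aug K n ^ (k+1)) :
    F a - a ∈ aug K n ^ (k + 1 + r) :=
  NoLift.unip (F : FreeAlgebra K (Fin n) →ₐ[K] FreeAlgebra K (Fin n)) h.eps hu k a ha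

lemma IsL.cong (h : IsL F φ) (k : Fin n) (p : FreeAlgebra K (Fin n))
    (hp : φ (X k) = NoLift.ab K n p) : F (gx K k) - p ∈ aug K n ^ 2 :=
  ab_congr (by rw [h.ab, ab_gx, hp])

lemma IsL.cong_unip (h : IsL F φ) (p : Fin n → FreeAlgebra K (Fin n))
    (hp : ∀ k, φ (X k) = X k + NoLift.ab K n (p k)) (hp2 : ∀ k, p k ∈ aug K n ^ 2) (k : Fin n) :
    F (gx K k) - gx K k ∈ aug K n ^ 2 := by
  have := h.cong k (gx K k + p k) (by rw [hp, map_add, ab_gx])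
  have h2 := add_mem this (hp2 k)
  convert h2 using 1; abel

lemma IsL.bet_comp (h : IsL F φ) (u u' v v' : Fin n → K)
    (hu : ∀ i, lam u (F (gx K i)) = u' i) (hv : ∀ i, lam v (F (gx K i)) = v' i)
    {q : FreeAlgebra K (Fin n)} (hq : q ∈ aug K n ^ 2) : bet u v (F q) = bet u' v' q :=
  NoLift.bet_comp u u' v v' (F : FreeAlgebra K (Fin n) →ₐ[K] FreeAlgebra K (Fin n)) h.eps hu hv hq

lemma lam_congr (u : Fin n → K) {a b : FreeAlgebra K (Fin n)} (h : a - b ∈ aug K n ^ 2) :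
    lam u a = lam u b := by
  have := lam_kill u h
  rw [lam_sub] at this
  exact sub_eq_zero.1 this

lemma equiv_rel (hF' : IsL F' φ') {r m : ℕ}
    (hu : ∀ i, F' (gx K i) - gx K i ∈ aug K n ^ (r+1)) (comm : ∀ a, G (F a) = F' (G a))
    (k : Fin n) (l : FreeAlgebra K (Fin n)) (hl : G (gx K k) - l ∈ aug K n ^ (m+1)) :
    G (F (gx K k) - gx K k) - (F' l - l) ∈ aug K n ^ (m+1+r) := by
  have := hF'.unip hu m hl
  convert this using 1
  rw [map_sub, comm, map_sub]; abel

lemma gg_mem (i j : Fin n) : gx K i * gx K j ∈ aug K n ^ 2 := by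
  rw [sq]; exact Submodule.mul_mem_mul (gx_mem i) (gx_mem j)

/-- a lifting of the group -/
structure IsLift (Ψ : (MvPolynomial (Fin n) K ≃ₐ[K] MvPolynomial (Fin n) K) →
        (FreeAlgebra K (Fin n) ≃ₐ[K] FreeAlgebra K (Fin n))) : Prop where
  mul : ∀ φ ψ, OriginPres φ → OriginPres ψ → Ψ (φ * ψ) = Ψ φ * Ψ ψ
  isL : ∀ φ, OriginPres φ → IsL (Ψ φ) φ

variable {Ψ : (MvPolynomial (Fin n) K ≃ₐ[K] MvPolynomial (Fin n) K) →
        (FreeAlgebra K (Fin n) ≃ₐ[K] FreeAlgebra K (Fin n))}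

lemma IsLift.comm (H : IsLift Ψ) {a b c d : MvPolynomial (Fin n) K ≃ₐ[K] MvPolynomial (Fin n) K}
    (ha : OriginPres a) (hb : OriginPres b) (hc : OriginPres c) (hd : OriginPres d)
    (h : ∀ k, a (b (X k)) = c (d (X k))) (t) : Ψ a (Ψ b t) = Ψ c (Ψ d t) := by
  have h1 : a * b = c * d := aut_ext h
  have h2 : Ψ a * Ψ b = Ψ c * Ψ d := by rw [← H.mul _ _ ha hb, h1, H.mul _ _ hc hd]
  exact DFunLike.congr_fun h2 t

/-- the quadratic part is additive -/
lemma quad_add (hF : IsL F φ) (hu : ∀ i, F (gx K i) - gx K i ∈ aug K n ^ 2) (k : Fin n)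
    (hk : G (gx K k) - gx K k ∈ aug K n ^ 2) :
    (F (G (gx K k)) - gx K k) - ((F (gx K k) - gx K k) + (G (gx K k) - gx K k))
      ∈ aug K n ^ 3 := by
  have := hF.unip (r := 1) hu 1 hk
  convert this using 1
  rw [map_sub]; abel

lemma op_mul (hφ : OriginPres φ) (hψ : OriginPres ψ) (hL : IsLift Ψ) : OriginPres (φ * ψ) := by
  intro i
  have h1 := (hL.isL φ hφ)
  have h2 := (hL.isL ψ hψ)
  have : (φ * ψ) (X i) = NoLift.ab K n (Ψ φ (Ψ ψ (gx K i))) := by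
    rw [h1.ab, h2.ab, ab_gx]; rfl
  rw [this, ← eps_eq, h1.eps, h2.eps, eps_gx]

lemma IsLift.sh_unip (H : IsLift Ψ) (z : Fin n) (f : MvPolynomial (Fin n) K) (hf : Indep z f)
    (p : FreeAlgebra K (Fin n)) (hp : p ∈ aug K n ^ 2) (hfp : f = ab K n p)
    (ho : OriginPres (sh z f hf)) (k : Fin n) :
    Ψ (sh z f hf) (gx K k) - gx K k ∈ aug K n ^ 2 := by
  refine (H.isL _ ho).cong_unip (fun k => if k = z then p else 0) (fun k => ?_) (fun k => ?_) k
  · by_cases hk : k = z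
    · subst hk; simp [sh_self, hfp]
    · simp [sh_ne _ _ _ _ hk, hk]
  · split_ifs
    · exact hp
    · exact zero_mem _

theorem char_two (H : IsLift Ψ) (x y z : Fin n) (hxy : x ≠ y) (hxz : x ≠ z) (hyz : y ≠ z)
    (h2 : (2 : K) = 0) : False := by
  have iP : Indep z (X x * X y : MvPolynomial (Fin n) K) := fun g => by simp [hxz, hyz]
  have iQ : Indep z (X y ^ 2 : MvPolynomial (Fin n) K) := fun g => by simp [hyz]
  have iR : Indep z (X x ^ 2 : MvPolynomial (Fin n) K) := fun g => by simp [hxz]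
  have iU : Indep x (X y : MvPolynomial (Fin n) K) := fun g => by simp [hxy.symm]
  have oP := sh_op _ _ iP (by simp)
  have oQ := sh_op _ _ iQ (by simp)
  have oR := sh_op _ _ iR (by simp)
  have oU := sh_op _ _ iU (by simp)
  have LP := H.isL _ oP
  have LQ := H.isL _ oQ
  have LR := H.isL _ oR
  have LU := H.isL _ oU
  have oPQ := op_mul oP oQ H
  have oRQ := op_mul oR oQ H
  have LPQ := H.isL _ oPQ
  have LRQ := H.isL _ oRQ
  have X2 : (2 : MvPolynomial (Fin n) K) = 0 := by
    have h : (C (2 : K) : MvPolynomial (Fin n) K) = 0 := by rw [h2, map_zero]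
    rw [map_ofNat] at h
    exact h
  have cP := H.comm oU oP oPQ oU (fun k => by
    rw [AlgEquiv.mul_apply]
    by_cases hkz : k = z
    · subst hkz
      simp only [sh_self, sh_ne _ _ _ _ hxz.symm, map_add, map_mul, map_pow, sh_ne _ _ _ _ hxy.symm,
        sh_ne _ _ _ _ hyz]
      ring
    · by_cases hkx : k = x
      · subst hkx
        simp only [sh_self, sh_ne _ _ _ _ hxz, map_add, sh_ne _ _ _ _ hyz]
      · simp only [sh_ne _ _ _ _ hkz, sh_ne _ _ _ _ hkx])
  have cR := H.comm oU oR oRQ oU (fun k => by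
    rw [AlgEquiv.mul_apply]
    by_cases hkz : k = z
    · subst hkz
      simp only [sh_self, sh_ne _ _ _ _ hxz.symm, map_add, map_mul, map_pow, sh_ne _ _ _ _ hxy.symm,
        sh_ne _ _ _ _ hyz]
      linear_combination (X x * X y) * X2
    · by_cases hkx : k = x
      · subst hkx
        simp only [sh_self, sh_ne _ _ _ _ hxz, map_add, sh_ne _ _ _ _ hyz]
      · simp only [sh_ne _ _ _ _ hkz, sh_ne _ _ _ _ hkx])
  have uP := H.sh_unip z _ iP (gx K x * gx K y) (gg_mem _ _) (by simp) oP
  have uQ := H.sh_unip z _ iQ (gx K y * gx K y) (gg_mem _ _) (by simp [sq]) oQ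
  have uR := H.sh_unip z _ iR (gx K x * gx K x) (gg_mem _ _) (by simp [sq]) oR
  have ePQ : ∀ t, Ψ (sh z _ iP * sh z _ iQ) t = Ψ (sh z _ iP) (Ψ (sh z _ iQ) t) := fun t => by
    rw [H.mul _ _ oP oQ]; rfl
  have eRQ : ∀ t, Ψ (sh z _ iR * sh z _ iQ) t = Ψ (sh z _ iR) (Ψ (sh z _ iQ) t) := fun t => by
    rw [H.mul _ _ oR oQ]; rfl
  have aPQ := fun k => quad_add LP uP k (uQ k)
  have aRQ := fun k => quad_add LR uR k (uQ k)
  have uPQ : ∀ k, Ψ (sh z _ iP * sh z _ iQ) (gx K k) - gx K k ∈ aug K n ^ 2 := fun k => by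
    have := add_mem (aug_le 1 3 (by norm_num) (aPQ k)) (add_mem (uP k) (uQ k))
    rw [ePQ]; convert this using 1; abel
  have uRQ : ∀ k, Ψ (sh z _ iR * sh z _ iQ) (gx K k) - gx K k ∈ aug K n ^ 2 := fun k => by
    have := add_mem (aug_le 1 3 (by norm_num) (aRQ k)) (add_mem (uR k) (uQ k))
    rw [eRQ]; convert this using 1; abel
  have hz := LU.cong z (gx K z) (by simp [sh_ne _ _ _ _ hxz.symm])
  have rP := equiv_rel (r := 1) (m := 1) LPQ uPQ cP z (gx K z) hz
  have rR := equiv_rel (r := 1) (m := 1) LRQ uRQ cR z (gx K z) hz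
  rw [ePQ] at rP
  rw [eRQ] at rR
  have linU : ∀ u : Fin n → K, ∀ i,
      lam u (Ψ (sh x _ iU) (gx K i)) = u i + if i = x then u y else 0 := by
    intro u i
    by_cases hi : i = x
    · subst hi
      rw [lam_congr u (LU.cong i (gx K i + gx K y) (by simp [sh_self])), lam_add]
      simp
    · rw [lam_congr u (LU.cong i (gx K i) (by simp [sh_ne _ _ _ _ hi]))]
      simp [hi]
  let ex : Fin n → K := Pi.single x 1
  let ey : Fin n → K := Pi.single y 1
  have lx : ∀ i, lam ex (Ψ (sh x _ iU) (gx K i)) = ex i := fun i => by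
    rw [linU]; simp [ex, hxy.symm]
  have ly : ∀ i, lam ey (Ψ (sh x _ iU) (gx K i)) = (ex + ey) i := fun i => by
    rw [linU]; simp [ex, ey, Pi.single_apply, add_comm]
  have bP := bet_congr ex ey rP
  have bR := bet_congr ex ey rR
  rw [LU.bet_comp _ _ _ _ lx ly (uP z), bet_add_right _ _ _ (uP z),
    bet_congr ex ey (aPQ z), bet_add] at bP
  rw [LU.bet_comp _ _ _ _ lx ly (uR z), bet_add_right _ _ _ (uR z),
    bet_congr ex ey (aRQ z), bet_add] at bR
  have dP : bet ex ex (Ψ (sh z _ iP) (gx K z) - gx K z) = 0 := by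
    have h1 := bet_diag ex (a := Ψ (sh z _ iP) (gx K z) - gx K z - gx K x * gx K y)
      (by simp [LP.ab, sh_self])
    rw [bet_sub, bet_mul _ _ (gx_mem _) (gx_mem _)] at h1
    simpa [ex, hxy, hxy.symm] using h1
  have dR : bet ex ex (Ψ (sh z _ iR) (gx K z) - gx K z) = 1 := by
    have h1 := bet_diag ex (a := Ψ (sh z _ iR) (gx K z) - gx K z - gx K x * gx K x)
      (by rw [map_sub, map_sub, LR.ab, ab_gx, sh_self, map_mul, ab_gx]; ring)
    rw [bet_sub, bet_mul _ _ (gx_mem _) (gx_mem _)] at h1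
    simpa [ex, sub_eq_zero] using h1
  rw [dP] at bP
  rw [dR] at bR
  have : (1 : K) = 0 := by linear_combination bR - bP
  exact one_ne_zero this

end lifts
end NoLift

namespace NoLift

section cubic
variable {K : Type*} [Field K] {n : ℕ}
variable {Ψ : (MvPolynomial (Fin n) K ≃ₐ[K] MvPolynomial (Fin n) K) →
        (FreeAlgebra K (Fin n) ≃ₐ[K] FreeAlgebra K (Fin n))}

lemma indep_sq (i j : Fin n) (hij : j ≠ i) (c : K) :
    Indep i (C c * X j ^ 2 : MvPolynomial (Fin n) K) := fun g => by
  simp [hij, algHom_C]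

lemma indep_X (i j : Fin n) (hij : j ≠ i) :
    Indep i (X j : MvPolynomial (Fin n) K) := fun g => by
  simp [hij]

/-- the automorphism `x_i ↦ x_i + c x_j^2` -/
noncomputable abbrev qd (i j : Fin n) (hij : j ≠ i) (c : K) :
    MvPolynomial (Fin n) K ≃ₐ[K] MvPolynomial (Fin n) K :=
  sh i (C c * X j ^ 2) (indep_sq i j hij c)

/-- the automorphism `x_i ↦ x_i + x_j` -/
noncomputable abbrev li (K : Type*) [Field K] {n : ℕ} (i j : Fin n) (hij : j ≠ i) :
    MvPolynomial (Fin n) K ≃ₐ[K] MvPolynomial (Fin n) K :=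
  sh i (X j) (indep_X i j hij)

lemma qd_op (i j : Fin n) (hij : j ≠ i) (c : K) : OriginPres (qd i j hij c) :=
  sh_op _ _ _ (by simp)

lemma li_op (i j : Fin n) (hij : j ≠ i) : OriginPres (li K i j hij) :=
  sh_op _ _ _ (by simp)

lemma li_lam (H : IsLift Ψ) (x y : Fin n) (hxy : y ≠ x) (u : Fin n → K) (i : Fin n) :
    lam u (Ψ (li K x y hxy) (gx K i)) = u i + if i = x then u y else 0 := by
  have LU := H.isL _ (li_op (K := K) x y hxy)
  by_cases hi : i = x
  · subst hi
    rw [lam_congr u (LU.cong i (gx K i + gx K y) (by simp [sh_self])), lam_add]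
    simp
  · rw [lam_congr u (LU.cong i (gx K i) (by simp [sh_ne _ _ _ _ hi]))]
    simp [hi]

lemma qd_unip (H : IsLift Ψ) (i j : Fin n) (hij : j ≠ i) (c : K) (k : Fin n) :
    Ψ (qd i j hij c) (gx K k) - gx K k ∈ aug K n ^ 2 :=
  H.sh_unip i _ _ (c • (gx K j * gx K j)) (Submodule.smul_mem _ _ (gg_mem _ _))
    (by rw [map_smul, map_mul, ab_gx, smul_eq_C_mul, sq]) (qd_op i j hij c) k

lemma sign_step (H : IsLift Ψ) (h2 : (2 : K) ≠ 0) (i j : Fin n) (hij : j ≠ i) (c : K)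
    (w : Fin n) (hw : w ≠ i) (p q k : Fin n) (hpq : p ≠ q) (hw' : p = w ∨ q = w) (hk : k ≠ w) :
    bet (Pi.single p 1) (Pi.single q 1) (Ψ (qd i j hij c) (gx K k) - gx K k) = 0 := by
  have LG := H.isL _ (sg_op (K := K) w)
  have LF := H.isL _ (qd_op i j hij c)
  have cm := H.comm (sg_op w) (qd_op i j hij c) (qd_op i j hij c) (sg_op w) (fun k => by
    by_cases hki : k = i
    · subst hki
      by_cases hj : j = w
      · subst hj
        simp only [sh_self, sg_ne _ _ hw.symm, map_add, map_mul, map_pow, sg_self,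
          AlgEquiv.commutes, ← algebraMap_eq]
        ring
      · simp only [sh_self, sg_ne _ _ hw.symm, map_add, map_mul, map_pow, sg_ne _ _ hj,
          AlgEquiv.commutes, ← algebraMap_eq]
    · by_cases hkw : k = w
      · subst hkw
        simp only [sh_ne _ _ _ _ hki, sg_self, map_neg]
      · simp only [sh_ne _ _ _ _ hki, sg_ne _ _ hkw])
  have rel := equiv_rel (r := 1) (m := 1) LF (qd_unip H i j hij c) cm k (gx K k)
    (LG.cong k (gx K k) (by rw [sg_ne _ _ hk, ab_gx]))
  have b := bet_congr (Pi.single p 1) (Pi.single q 1) rel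
  have lin : ∀ p i : Fin n, lam (Pi.single p 1) (Ψ (sg w) (gx K i)) =
      ((if p = w then (-1 : K) else 1) • (Pi.single p 1 : Fin n → K)) i := by
    intro p i
    by_cases hi : i = w
    · subst hi
      rw [lam_congr _ (LG.cong i (-gx K i) (by rw [sg_self, map_neg, ab_gx])),
        ← zero_sub, lam_sub]
      by_cases hp : p = i
      · subst hp; simp [lam]; simp [tst_gx]
      · simp [hp, lam, Ne.symm hp]
        simp [tst_gx, Ne.symm hp]
    · rw [lam_congr _ (LG.cong i (gx K i) (by rw [sg_ne _ _ hi, ab_gx]))]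
      by_cases hp : p = w
      · subst hp; simp [hi]
      · simp [hp]
  rw [LG.bet_comp _ _ _ _ (lin p) (lin q) (qd_unip H i j hij c k),
    bet_smul_smul _ _ _ _ (qd_unip H i j hij c k)] at b
  have hs : (if p = w then (-1 : K) else 1) * (if q = w then (-1 : K) else 1) = -1 := by
    rcases hw' with rfl | rfl
    · simp [hpq.symm]
    · simp [hpq]
  rw [hs] at b
  have : (2 : K) * bet (Pi.single p 1) (Pi.single q 1) (Ψ (qd i j hij c) (gx K k) - gx K k) = 0 := by
    linear_combination -b
  exact (mul_eq_zero.1 this).resolve_left h2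

lemma diag_zero (H : IsLift Ψ) (i j : Fin n) (hij : j ≠ i) (c : K) (k : Fin n) (u : Fin n → K) :
    bet u u (Ψ (qd i j hij c) (gx K k) - gx K k - if k = i then c • (gx K j * gx K j) else 0)
      = 0 := by
  apply bet_diag
  rw [map_sub, map_sub, (H.isL _ (qd_op i j hij c)).ab, ab_gx]
  by_cases hk : k = i
  · subst hk
    rw [sh_self, if_pos rfl, map_smul, map_mul, ab_gx, smul_eq_C_mul]
    ring
  · simp [sh_ne _ _ _ _ hk, hk]

lemma quad_zero (H : IsLift Ψ) (h2 : (2 : K) ≠ 0) (i j : Fin n) (hij : j ≠ i) (c : K)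
    (p q k : Fin n) (hpq : p ≠ q) :
    bet (Pi.single p 1) (Pi.single q 1) (Ψ (qd i j hij c) (gx K k) - gx K k) = 0 := by
  have rest : ∀ w, w ≠ i →
      bet (Pi.single w 1) (Pi.single i 1) (Ψ (qd i j hij c) (gx K w) - gx K w) = 0 ∧
      bet (Pi.single i 1) (Pi.single w 1) (Ψ (qd i j hij c) (gx K w) - gx K w) = 0 := by
    intro w hw
    have LF := H.isL _ (qd_op i j hij c)
    have LG := H.isL _ (li_op (K := K) i w hw)
    have cm := H.comm (li_op i w hw) (qd_op i j hij c) (qd_op i j hij c) (li_op i w hw)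
      (fun k => by
        by_cases hki : k = i
        · subst hki
          simp only [sh_self, map_add, map_mul, map_pow, sh_ne _ _ _ _ hij, sh_ne _ _ _ _ hw,
            AlgEquiv.commutes, ← algebraMap_eq]
          ring
        · simp only [sh_ne _ _ _ _ hki])
    have rel := equiv_rel (r := 1) (m := 1) LF (qd_unip H i j hij c) cm i (gx K i + gx K w)
      (LG.cong i _ (by simp [sh_self]))
    have dd := diag_zero H i j hij c i (Pi.single i 1)
    rw [if_pos rfl, bet_sub, bet_smul, bet_mul _ _ (gx_mem _) (gx_mem _)] at dd
    have dd' : bet (Pi.single i 1) (Pi.single i 1) (Ψ (qd i j hij c) (gx K i) - gx K i) = 0 := by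
      simpa [hij] using dd
    have li1 : ∀ t, lam (Pi.single i 1) (Ψ (li K i w hw) (gx K t)) =
        (Pi.single i 1 : Fin n → K) t := fun t => by
      rw [li_lam H]; simp [hw]
    have li2 : ∀ t, lam (Pi.single w 1) (Ψ (li K i w hw) (gx K t)) =
        (Pi.single w 1 + Pi.single i 1 : Fin n → K) t := fun t => by
      rw [li_lam H]; simp [Pi.single_apply]
    have hu := qd_unip H i j hij c i
    have split : Ψ (qd i j hij c) (gx K i + gx K w) - (gx K i + gx K w) =
      (Ψ (qd i j hij c) (gx K i) - gx K i) + (Ψ (qd i j hij c) (gx K w) - gx K w) := by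
      rw [map_add]; abel
    rw [split] at rel
    constructor
    · have b := bet_congr (Pi.single w 1) (Pi.single i 1) rel
      rw [LG.bet_comp _ _ _ _ li2 li1 hu, bet_add_left _ _ _ hu, bet_add, dd'] at b
      linear_combination -b
    · have b := bet_congr (Pi.single i 1) (Pi.single w 1) rel
      rw [LG.bet_comp _ _ _ _ li1 li2 hu, bet_add_right _ _ _ hu, bet_add, dd'] at b
      linear_combination -b
  by_cases hp : p = i
  · subst hp
    by_cases hk : k = q
    · subst hk; exact (rest k hpq.symm).2
    · exact sign_step H h2 _ _ _ _ q hpq.symm _ _ _ hpq (Or.inr rfl) hk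
  · by_cases hk : k = p
    · subst hk
      by_cases hq : q = i
      · subst hq; exact (rest k hp).1
      · exact sign_step H h2 _ _ _ _ q hq _ _ _ hpq (Or.inr rfl) hpq
    · exact sign_step H h2 _ _ _ _ p hp _ _ _ hpq (Or.inl rfl) hk

/-- lifts of `x_i ↦ x_i + c x_j^2` are standard modulo cubic terms -/
lemma claimB (H : IsLift Ψ) (h2 : (2 : K) ≠ 0) (i j : Fin n) (hij : j ≠ i) (c : K) (k : Fin n) :
    Ψ (qd i j hij c) (gx K k) - gx K k - (if k = i then c • (gx K j * gx K j) else 0)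
      ∈ aug K n ^ 3 := by
  have hn : (if k = i then c • (gx K j * gx K j) else 0) ∈ aug K n ^ 2 := by
    split_ifs
    · exact Submodule.smul_mem _ _ (gg_mem _ _)
    · exact zero_mem _
  refine mem_cube (sub_mem (qd_unip H i j hij c k) hn) fun p q => ?_
  by_cases hpq : p = q
  · subst hpq; exact diag_zero H i j hij c k _
  · rw [bet_sub, quad_zero H h2 i j hij c p q k hpq]
    split_ifs
    · rw [bet_smul, bet_mul _ _ (gx_mem _) (gx_mem _), lam_gx, lam_gx]
      by_cases hj : j = p
      · subst hj; simp [hpq]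
      · simp [hj]
    · simp

end cubic
end NoLift

namespace NoLift

section final
variable {K : Type*} [Field K] {n : ℕ}
variable {Ψ : (MvPolynomial (Fin n) K ≃ₐ[K] MvPolynomial (Fin n) K) →
        (FreeAlgebra K (Fin n) ≃ₐ[K] FreeAlgebra K (Fin n))}

lemma IsLift.prod (H : IsLift Ψ) {a b c : MvPolynomial (Fin n) K ≃ₐ[K] MvPolynomial (Fin n) K}
    (ha : OriginPres a) (hb : OriginPres b)
    (h : ∀ k, a (b (X k)) = c (X k)) (t) : Ψ a (Ψ b t) = Ψ c t := by
  have h1 : a * b = c := aut_ext h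
  rw [← h1, H.mul _ _ ha hb]; rfl

lemma sh_C (i : Fin n) (f : MvPolynomial (Fin n) K) (hf : Indep i f) (c : K) :
    sh i f hf (C c) = C c := (sh i f hf).commutes c

/-- the cubic word `a b b + b b a` -/
noncomputable def wd (a b : FreeAlgebra K (Fin n)) : FreeAlgebra K (Fin n) :=
  a * b * b + b * b * a

lemma indep_s (x y z : Fin n) (hxz : x ≠ z) (hyz : y ≠ z) (c : K) :
    Indep z ((X x + C c * X y ^ 2) ^ 2 : MvPolynomial (Fin n) K) := fun g => by
  simp [hxz, hyz, algHom_C]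

/-- conjugate of a quadratic elementary automorphism -/
noncomputable abbrev cj (x y z : Fin n) (hxz : x ≠ z) (hyz : y ≠ z) (c : K) :
    MvPolynomial (Fin n) K ≃ₐ[K] MvPolynomial (Fin n) K :=
  sh z ((X x + C c * X y ^ 2) ^ 2) (indep_s x y z hxz hyz c)

lemma cj_op (x y z : Fin n) (hxz : x ≠ z) (hyz : y ≠ z) (c : K) :
    OriginPres (cj x y z hxz hyz c) := sh_op _ _ _ (by simp)

lemma cj_unip (H : IsLift Ψ) (x y z : Fin n) (hxz : x ≠ z) (hyz : y ≠ z) (c : K) (k : Fin n) :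
    Ψ (cj x y z hxz hyz c) (gx K k) - gx K k ∈ aug K n ^ 2 := by
  have hm : gx K x + c • (gx K y * gx K y) ∈ aug K n := by
    refine add_mem (gx_mem x) (Submodule.smul_mem _ _ ?_)
    have := aug_le (K := K) (n := n) 0 2 (by norm_num) (gg_mem y y)
    simpa using this
  refine H.sh_unip z _ _ ((gx K x + c • (gx K y * gx K y)) * (gx K x + c • (gx K y * gx K y)))
    (by rw [sq]; exact Submodule.mul_mem_mul hm hm) ?_ (cj_op x y z hxz hyz c) k
  rw [map_mul, map_add, map_smul, map_mul, ab_gx, ab_gx, smul_eq_C_mul]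
  ring

lemma cj_step (H : IsLift Ψ) (h2 : (2 : K) ≠ 0) (x y z : Fin n) (hyx : y ≠ x) (hxz : x ≠ z)
    (hyz : y ≠ z) (c : K) :
    (∀ k, Ψ (cj x y z hxz hyz c) (gx K k) - Ψ (qd z x hxz 1) (gx K k) ∈ aug K n ^ 3) ∧
    Ψ (cj x y z hxz hyz c) (gx K z) - Ψ (qd z x hxz 1) (gx K z) - c • wd (gx K x) (gx K y)
      ∈ aug K n ^ 4 := by
  have oT := qd_op z x hxz (1 : K)
  have oH := qd_op x y hyx c
  have oC := cj_op x y z hxz hyz c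
  have LT := H.isL _ oT
  have LH := H.isL _ oH
  have LC := H.isL _ oC
  have uH := qd_unip H x y hyx c
  have uT := qd_unip H z x hxz (1 : K)
  have uC := cj_unip H x y z hxz hyz c
  have cm := H.comm oH oT oC oH (fun k => by
    by_cases hkz : k = z
    · subst hkz
      simp only [sh_self, sh_ne _ _ _ _ hxz.symm, map_add, map_mul, map_pow, sh_C, C_1, one_mul]
    · by_cases hkx : k = x
      · subst hkx
        simp only [sh_self, sh_ne _ _ _ _ hxz, map_add, map_mul, map_pow, sh_C, sh_ne _ _ _ _ hyz]
      · simp only [sh_ne _ _ _ _ hkz, sh_ne _ _ _ _ hkx])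
  constructor
  · intro k
    have e1 := equiv_rel (r := 1) (m := 1) LC uC cm k (gx K k) (uH k)
    have e2 := LH.unip (r := 1) uH 1 (uT k)
    have := sub_mem e2 e1
    convert this using 1
    abel
  · have hz3 : Ψ (qd x y hyx c) (gx K z) - gx K z ∈ aug K n ^ 3 := by
      have := claimB H h2 x y hyx c z
      rwa [if_neg hxz.symm, sub_zero] at this
    have e1 := equiv_rel (r := 1) (m := 2) LC uC cm z (gx K z) hz3
    have hr : Ψ (qd z x hxz 1) (gx K z) - gx K z - gx K x * gx K x ∈ aug K n ^ 3 := by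
      have := claimB H h2 z x hxz 1 z
      rwa [if_pos rfl, one_smul] at this
    have e2 := LH.unip (r := 1) uH 2 hr
    have hs : Ψ (qd x y hyx c) (gx K x) - gx K x - c • (gx K y * gx K y) ∈ aug K n ^ 3 := by
      have := claimB H h2 x y hyx c x
      rwa [if_pos rfl] at this
    have e3 : Ψ (qd x y hyx c) (gx K x * gx K x) - gx K x * gx K x - c • wd (gx K x) (gx K y)
        ∈ aug K n ^ 4 := by
      have hx1 : gx K x ∈ aug K n ^ 1 := by rw [pow_one]; exact gx_mem x
      have f1 := aug_mul (uH x) (uH x)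
      have f2 := aug_mul hx1 hs
      have f3 := aug_mul hs hx1
      have := add_mem (add_mem f1 f2) f3
      convert this using 1
      rw [map_mul, wd]
      simp only [sub_mul, mul_sub, smul_add, mul_smul_comm, smul_mul_assoc, mul_assoc]
      abel
    have := sub_mem (add_mem e2 e3) e1
    convert this using 1
    simp only [map_sub]
    abel

lemma indep_c (x y z : Fin n) (hxz : x ≠ z) (hyz : y ≠ z) :
    Indep z (C 4 * (X x * X y ^ 2) : MvPolynomial (Fin n) K) := fun g => by
  simp [hxz, hyz]

/-- the automorphism `z ↦ z + 4 x y^2` -/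
noncomputable abbrev cu (K : Type*) [Field K] {n : ℕ} (x y z : Fin n) (hxz : x ≠ z)
    (hyz : y ≠ z) : MvPolynomial (Fin n) K ≃ₐ[K] MvPolynomial (Fin n) K :=
  sh z (C 4 * (X x * X y ^ 2)) (indep_c x y z hxz hyz)

lemma cu_op (x y z : Fin n) (hxz : x ≠ z) (hyz : y ≠ z) :
    OriginPres (cu K x y z hxz hyz) := sh_op _ _ _ (by simp)

lemma cu_step (H : IsLift Ψ) (h2 : (2 : K) ≠ 0) (x y z : Fin n) (hyx : y ≠ x) (hxz : x ≠ z)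
    (hyz : y ≠ z) :
    (∀ k, Ψ (cu K x y z hxz hyz) (gx K k) - gx K k ∈ aug K n ^ 3) ∧
    Ψ (cu K x y z hxz hyz) (gx K z) - gx K z - (2 : K) • wd (gx K x) (gx K y) ∈ aug K n ^ 4 := by
  have oM := cj_op x y z hxz hyz (-1 : K)
  have LM := H.isL _ oM
  have uM := cj_unip H x y z hxz hyz (-1 : K)
  have pr := H.prod (c := cj x y z hxz hyz (1 : K)) oM (cu_op x y z hxz hyz) (fun k => by
    by_cases hkz : k = z
    · subst hkz
      simp only [sh_self, sh_ne _ _ _ _ hxz, map_add, map_mul, map_pow, sh_C, sh_ne _ _ _ _ hyz]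
      simp only [map_neg, map_one, map_ofNat]
      ring
    · simp only [sh_ne _ _ _ _ hkz])
  obtain ⟨a1, b1⟩ := cj_step H h2 x y z hyx hxz hyz 1
  obtain ⟨a2, b2⟩ := cj_step H h2 x y z hyx hxz hyz (-1)
  have h3 : ∀ k, Ψ (cu K x y z hxz hyz) (gx K k) - gx K k ∈ aug K n ^ 3 := by
    intro k
    apply LM.of_mem
    have := sub_mem (a1 k) (a2 k)
    rw [map_sub, pr]
    convert this using 1
    abel
  refine ⟨h3, ?_⟩
  have e := LM.unip (r := 1) uM 2 (h3 z)
  rw [map_sub, pr] at e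
  have := sub_mem (sub_mem b1 b2) e
  convert this using 1
  rw [one_smul, neg_one_smul, two_smul]
  abel

lemma l_step {F F' G : FreeAlgebra K (Fin n) ≃ₐ[K] FreeAlgebra K (Fin n)}
    {φ' ψ : MvPolynomial (Fin n) K ≃ₐ[K] MvPolynomial (Fin n) K}
    (hF' : IsL F' φ') (hG : IsL G ψ) (hu : ∀ k, F (gx K k) - gx K k ∈ aug K n ^ 3)
    (cm : ∀ a, G (F a) = F' (G a)) (z : Fin n) (hz : G (gx K z) - gx K z ∈ aug K n ^ 2) :
    (∀ k, F' (gx K k) - gx K k ∈ aug K n ^ 3) ∧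
    G (F (gx K z) - gx K z) - (F' (gx K z) - gx K z) ∈ aug K n ^ 4 := by
  have h3 : ∀ k, F' (gx K k) - gx K k ∈ aug K n ^ 3 := by
    intro k
    have := hG.mem (unip_all (r := 2)
      (F : FreeAlgebra K (Fin n) →ₐ[K] FreeAlgebra K (Fin n)) hu (G.symm (gx K k)))
    rw [map_sub] at this
    simpa [cm] using this
  exact ⟨h3, equiv_rel (r := 2) (m := 1) hF' h3 cm z (gx K z) hz⟩

lemma add_four {F : FreeAlgebra K (Fin n) ≃ₐ[K] FreeAlgebra K (Fin n)}
    {φ : MvPolynomial (Fin n) K ≃ₐ[K] MvPolynomial (Fin n) K}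
    (hF : IsL F φ) (hu : ∀ k, F (gx K k) - gx K k ∈ aug K n ^ 3) (z : Fin n)
    (g : FreeAlgebra K (Fin n)) (hg : g - gx K z ∈ aug K n ^ 3) :
    (F g - gx K z) - ((F (gx K z) - gx K z) + (g - gx K z)) ∈ aug K n ^ 4 := by
  have := aug_le 3 5 (by norm_num) (hF.unip (r := 2) hu 2 hg)
  convert this using 1
  rw [map_sub]; abel

lemma indep_1 (x y z : Fin n) (hxz : x ≠ z) (hyz : y ≠ z) :
    Indep z (C 4 * ((X x + X y) * X y ^ 2) : MvPolynomial (Fin n) K) := fun g => by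
  simp [hxz, hyz]

lemma indep_2 (x y z : Fin n) (hxz : x ≠ z) (hyz : y ≠ z) :
    Indep z (C 4 * (X y * (X x + X y) ^ 2) : MvPolynomial (Fin n) K) := fun g => by
  simp [hxz, hyz]

theorem char_ne_two (H : IsLift Ψ) (h2 : (2 : K) ≠ 0) (x y z : Fin n) (hyx : y ≠ x)
    (hxz : x ≠ z) (hyz : y ≠ z) : False := by
  have i1 := indep_1 (K := K) x y z hxz hyz
  have i2 := indep_2 (K := K) x y z hxz hyz
  have o1 := sh_op _ _ i1 (by simp)
  have o2 := sh_op _ _ i2 (by simp)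
  have of1 := cu_op (K := K) x y z hxz hyz
  have of2 := cu_op (K := K) y x z hyz hxz
  have oG := li_op (K := K) x y hyx
  have L1 := H.isL _ o1
  have L2 := H.isL _ o2
  have Lf1 := H.isL _ of1
  have LG := H.isL _ oG
  obtain ⟨a1, b1⟩ := cu_step H h2 x y z hyx hxz hyz
  obtain ⟨a2, b2⟩ := cu_step H h2 y x z hyx.symm hyz hxz
  have cm1 := H.comm oG of1 o1 oG (fun k => by
    by_cases hkz : k = z
    · subst hkz
      simp only [sh_self, sh_ne _ _ _ _ hxz.symm, map_add, map_mul, map_pow, sh_C,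
        sh_ne _ _ _ _ hyx]
    · by_cases hkx : k = x
      · subst hkx
        simp only [sh_self, sh_ne _ _ _ _ hxz, map_add, sh_ne _ _ _ _ hyz]
      · simp only [sh_ne _ _ _ _ hkz, sh_ne _ _ _ _ hkx])
  have cm2 := H.comm oG of2 o2 oG (fun k => by
    by_cases hkz : k = z
    · subst hkz
      simp only [sh_self, sh_ne _ _ _ _ hxz.symm, map_add, map_mul, map_pow, sh_C,
        sh_ne _ _ _ _ hyx]
    · by_cases hkx : k = x
      · subst hkx
        simp only [sh_self, sh_ne _ _ _ _ hxz, map_add, sh_ne _ _ _ _ hyz]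
      · simp only [sh_ne _ _ _ _ hkz, sh_ne _ _ _ _ hkx])
  have hz : Ψ (li K x y hyx) (gx K z) - gx K z ∈ aug K n ^ 2 :=
    LG.cong z (gx K z) (by rw [sh_ne _ _ _ _ hxz.symm, ab_gx])
  obtain ⟨u1, v1⟩ := l_step L1 LG a1 cm1 z hz
  obtain ⟨u2, v2⟩ := l_step L2 LG a2 cm2 z hz
  have pr : ∀ t, Ψ (sh z _ i1) (Ψ (cu K x y z hxz hyz) (Ψ (cu K y x z hyz hxz) t)) =
      Ψ (sh z _ i2) t := by
    intro t
    have := H.prod (c := sh z _ i2) o1 (op_mul of1 of2 H) (fun k => by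
      rw [AlgEquiv.mul_apply]
      by_cases hkz : k = z
      · subst hkz
        simp only [sh_self, map_add, map_mul, map_pow, sh_C, sh_ne _ _ _ _ hxz, sh_ne _ _ _ _ hyz]
        ring
      · simp only [sh_ne _ _ _ _ hkz]) t
    rw [H.mul _ _ of1 of2] at this
    exact this
  have s1 := add_four Lf1 a1 z _ (a2 z)
  have g3 : Ψ (cu K x y z hxz hyz) (Ψ (cu K y x z hyz hxz) (gx K z)) - gx K z ∈ aug K n ^ 3 := by
    have := add_mem (aug_le 2 4 (by norm_num) s1) (add_mem (a1 z) (a2 z))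
    convert this using 1; abel
  have s2 := add_four L1 u1 z _ g3
  rw [pr] at s2
  let ex : Fin n → K := Pi.single x 1
  let ey : Fin n → K := Pi.single y 1
  have k1 := kap_congr ey ex ey s1
  have k2 := kap_congr ey ex ey s2
  have k3 := kap_congr ey ex ey v1
  have k4 := kap_congr ey ex ey v2
  have k5 := kap_congr ey ex ey b1
  have k6 := kap_congr ey ex ey b2
  have w1 := LG.mem b1
  have w2 := LG.mem b2
  rw [map_sub] at w1 w2
  have k7 := kap_congr ey ex ey w1
  have k8 := kap_congr ey ex ey w2
  have gm := LG.gx_mem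
  rw [kap_add] at k1 k2
  rw [map_smul, kap_smul] at k7 k8
  rw [kap_smul] at k5 k6
  have m1 : kap ey ex ey (wd (gx K x) (gx K y)) = 0 := by
    rw [wd, kap_add, kap_mul _ _ _ (gx_mem _) (gx_mem _) (gx_mem _),
      kap_mul _ _ _ (gx_mem _) (gx_mem _) (gx_mem _)]
    simp [ex, ey, hyx, hyx.symm]
  have m2 : kap ey ex ey (wd (gx K y) (gx K x)) = 0 := by
    rw [wd, kap_add, kap_mul _ _ _ (gx_mem _) (gx_mem _) (gx_mem _),
      kap_mul _ _ _ (gx_mem _) (gx_mem _) (gx_mem _)]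
    simp [ex, ey, hyx, hyx.symm]
  have m3 : kap ey ex ey (Ψ (li K x y hyx) (wd (gx K x) (gx K y))) = 0 := by
    rw [wd, map_add, map_mul, map_mul, map_mul, map_mul, kap_add,
      kap_mul _ _ _ (gm _) (gm _) (gm _), kap_mul _ _ _ (gm _) (gm _) (gm _)]
    simp only [li_lam H]
    simp [ex, ey, hyx, hyx.symm]
  have m4 : kap ey ex ey (Ψ (li K x y hyx) (wd (gx K y) (gx K x))) = 2 := by
    rw [wd, map_add, map_mul, map_mul, map_mul, map_mul, kap_add,
      kap_mul _ _ _ (gm _) (gm _) (gm _), kap_mul _ _ _ (gm _) (gm _) (gm _)]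
    simp only [li_lam H]
    simp [ex, ey, hyx, hyx.symm, one_add_one_eq_two]
  rw [m1] at k5
  rw [m2] at k6
  rw [m3] at k7
  rw [m4] at k8
  have : (2 : K) * 2 = 0 := by
    linear_combination k2 + k1 + k5 + k6 - k3 + k7 + k4 - k8
  exact h2 (mul_self_eq_zero.1 this)

end final
end NoLift

/-- **Non-lifting of the polynomial automorphism group.** Let `K` be a field and
`n > 2`, and let `ab : K⟨x_1,…,x_n⟩ → K[x_1,…,x_n]` be the abelianization. Then there
is no group homomorphism `Ψ` from the group `Aut_0(K[x_1,…,x_n])` of origin-preserving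
automorphisms to `Aut(K⟨x_1,…,x_n⟩)` with `ab ∘ Ψ(φ) = φ ∘ ab` for all `φ`. -/
theorem no_group_lifting_of_polynomial_automorphisms (K : Type*) [Field K]
    (n : ℕ) (hn : 2 < n) :
    ¬ ∃ Ψ : (MvPolynomial (Fin n) K ≃ₐ[K] MvPolynomial (Fin n) K) →
        (FreeAlgebra K (Fin n) ≃ₐ[K] FreeAlgebra K (Fin n)),
      (∀ φ ψ, OriginPres φ → OriginPres ψ → Ψ (φ * ψ) = Ψ φ * Ψ ψ) ∧
      (∀ φ, OriginPres φ → ∀ a : FreeAlgebra K (Fin n),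
        FreeAlgebra.lift K (fun i : Fin n => (MvPolynomial.X i : MvPolynomial (Fin n) K))
            ((Ψ φ) a) =
          φ (FreeAlgebra.lift K
            (fun i : Fin n => (MvPolynomial.X i : MvPolynomial (Fin n) K)) a)) := by
  rintro ⟨Ψ, h1, h2⟩
  have H : NoLift.IsLift Ψ := ⟨h1, fun φ hφ => ⟨hφ, h2 φ hφ⟩⟩
  have hxy : (⟨0, by omega⟩ : Fin n) ≠ ⟨1, by omega⟩ := by simp
  have hxz : (⟨0, by omega⟩ : Fin n) ≠ ⟨2, hn⟩ := by simp
  have hyz : (⟨1, by omega⟩ : Fin n) ≠ ⟨2, hn⟩ := by simp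
  by_cases h : (2 : K) = 0
  · exact NoLift.char_two H _ _ _ hxy hxz hyz h
  · exact NoLift.char_ne_two H h _ _ _ hxy.symm hxz hyz
end
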